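/- arXiv:1108.2866 — 2 statements merged into one kernel-verified Lean document; each statement's English description precedes it below -/
import Mathlib

section
/- Let a ≥ 4 be an integer and let G = C_{3·2^a}^3 (the direct sum of three copies of the cyclic group of order 3·2^a). Then C_0(G) is nonempty. -/
/-- `S` contains a short zero-sum subsequence: a nonempty subsequence with sum `0`
whose length is at most `exp(G)`. -/
def HasShortZeroSumSubseq {G : Type*} [AddCommGroup G] (S : Multiset G) : Prop :=
  ∃ T, T ≤ S ∧ T.sum = 0 ∧ 1 ≤ Multiset.card T ∧ Multiset.card T ≤ AddMonoid.exponent G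

/-- `η G` : the smallest `d` such that every sequence over `G` of length at least `d`
contains a short zero-sum subsequence. -/
noncomputable def etaConst (G : Type*) [AddCommGroup G] : ℕ :=
  sInf {d : ℕ | ∀ S : Multiset G, d ≤ Multiset.card S → HasShortZeroSumSubseq S}

/-- `D G` : the Davenport constant, the smallest `d` such that every sequence over `G`
of length at least `d` contains a nonempty zero-sum subsequence. -/
noncomputable def davenport (G : Type*) [AddCommGroup G] : ℕ :=
  sInf {d : ℕ | ∀ S : Multiset G, d ≤ Multiset.card S → ∃ T, T ≤ S ∧ T ≠ 0 ∧ T.sum = 0}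

/-- `C₀(G)` : the set of `t ∈ [D(G)+1, η(G)-1]` such that every zero-sum sequence over
`G` of length exactly `t` contains a short zero-sum subsequence. -/
def C0 (G : Type*) [AddCommGroup G] : Set ℕ :=
  {t | davenport G + 1 ≤ t ∧ t ≤ etaConst G - 1 ∧
    ∀ S : Multiset G, Multiset.card S = t → S.sum = 0 → HasShortZeroSumSubseq S}

/-- A finite set `X` of nonzero elements such that no nonempty sum of at most three terms
from `X` vanishes, apart from the sums `x + x + x`. -/
structure IsCap {F : Type*} [AddCommGroup F] (X : Finset F) : Prop where
  zero_notMem : 0 ∉ X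
  neg_notMem : ∀ x ∈ X, -x ∉ X
  neg_add_notMem : ∀ x ∈ X, ∀ y ∈ X, x ≠ y → -(x + y) ∉ X

theorem isCap_iff {F : Type*} [AddCommGroup F] {X : Finset F} : IsCap X ↔
    0 ∉ X ∧ (∀ x ∈ X, -x ∉ X) ∧ ∀ x ∈ X, ∀ y ∈ X, x ≠ y → -(x + y) ∉ X :=
  ⟨fun h => ⟨h.1, h.2, h.3⟩, fun h => ⟨h.1, h.2.1, h.2.2⟩⟩

/-- The additive relations satisfied by the eight-element caps of `C_3^3`. -/
structure IsQuadric {F : Type*} [AddCommGroup F] (X : Finset F) : Prop where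
  card_eq : X.card = 8
  sum_eq : ∑ x ∈ X, x = 0
  eq_add : ∀ p ∈ X, ∃ a ∈ X, ∃ b ∈ X, a ≠ b ∧ a ≠ p ∧ b ≠ p ∧ p = a + b
  add_eq : ∀ p ∈ X, ∀ q ∈ X, p ≠ q → ∃ a ∈ X, ∃ b ∈ X, (a ≠ p ∧ a ≠ q ∧ b ≠ p ∧ b ≠ q) ∧
    (a = p + q ∨ a ≠ b ∧ a + b = p + q)

namespace CapSearch

/-- The ambient group `C_3^3` of the search. -/
abbrev Pt := ZMod 3 × ZMod 3 × ZMod 3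

/-- The property required of the completed caps. -/
def Leaf (ch : List Pt) : Prop :=
  (ch.length = 7 ∧ ch.sum ≠ 0) ∨ (ch.length = 8 ∧ ch.sum = 0 ∧
    (∀ p ∈ ch, ∃ a ∈ ch, ∃ b ∈ ch, a ≠ b ∧ a ≠ p ∧ b ≠ p ∧ p = a + b) ∧
    ∀ p ∈ ch, ∀ q ∈ ch, p ≠ q → ∃ a ∈ ch, ∃ b ∈ ch, (a ≠ p ∧ a ≠ q ∧ b ≠ p ∧ b ≠ q) ∧
      (a = p + q ∨ a ≠ b ∧ a + b = p + q))

set_option synthInstance.maxSize 2000 in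
set_option synthInstance.maxHeartbeats 400000 in
instance (ch : List Pt) : Decidable (Leaf ch) := by unfold Leaf; infer_instance

/-- Whether `r` may still be chosen once `p` is added to `ch`. -/
def compat (ch : List Pt) (p r : Pt) : Bool :=
  decide (r ≠ p ∧ r + p ≠ 0 ∧ ∀ q ∈ ch, r + p + q ≠ 0)

/-- Depth-first search through the caps that contain `ch` and are contained in `ch ++ l`. -/
def search : ℕ → List Pt → List Pt → Bool
  | 0, _, _ => false
  | n + 1, l, ch =>
    if l.length + ch.length < 7 then true else
      match l with
      | [] => decide (Leaf ch)
      | p :: l' => search n l' ch && search n (l'.filter (compat ch p)) (p :: ch)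

theorem exists_leaf_of_search {X : Finset Pt} (hX : IsCap X) (h7 : 7 ≤ X.card) (n : ℕ) :
    ∀ l ch : List Pt, search n l ch = true → (∀ x ∈ X, x ∈ ch ∨ x ∈ l) → (∀ x ∈ ch, x ∈ X) →
      ch.Nodup → (∀ x ∈ l, x ∉ ch) → ∃ c : List Pt, c.Nodup ∧ (∀ x, x ∈ c ↔ x ∈ X) ∧ Leaf c := by
  induction n with
  | zero => intro l ch h; simp [search] at h
  | succ n ih =>
    intro l ch h hcov hsub hnd hdis
    rw [search.eq_def] at h
    dsimp only at h
    split_ifs at h with hlen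
    · exfalso
      have h1 : X ⊆ (ch ++ l).toFinset := fun x hx => by simpa using hcov x hx
      have h2 := (Finset.card_le_card h1).trans (List.toFinset_card_le _)
      simp only [List.length_append] at h2
      omega
    · cases l with
      | nil =>
        refine ⟨ch, hnd, fun x => ⟨hsub x, fun hx => by simpa using hcov x hx⟩, by simpa using h⟩
      | cons p l' =>
        simp only [Bool.and_eq_true] at h
        by_cases hp : p ∈ X
        · refine ih _ _ h.2 ?_ ?_ ?_ ?_
          · intro x hx
            rcases hcov x hx with hc | hc
            · simp [hc]
            · by_cases hxp : x = p
              · simp [hxp]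
              · right
                have hxl : x ∈ l' := by simpa [hxp] using hc
                simp only [List.mem_filter, hxl, compat, true_and, decide_eq_true_eq]
                refine ⟨hxp, fun h0 => ?_, fun q hq h0 => ?_⟩
                · exact hX.neg_notMem p hp (by rwa [← eq_neg_of_add_eq_zero_left h0])
                · have hqp : q ≠ p := fun e => hdis p (by simp) (e ▸ hq)
                  refine hX.neg_add_notMem p hp q (hsub q hq) hqp.symm ?_
                  rwa [← eq_neg_of_add_eq_zero_left (by rwa [← add_assoc] : x + (p + q) = 0)]
          · intro x hx
            rcases List.mem_cons.1 hx with rfl | hx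
            · exact hp
            · exact hsub x hx
          · exact List.nodup_cons.2 ⟨hdis p (by simp), hnd⟩
          · intro x hx
            simp only [List.mem_filter, compat, decide_eq_true_eq] at hx
            simp only [List.mem_cons, not_or]
            exact ⟨hx.2.1, hdis x (by simp [hx.1])⟩
        · refine ih _ _ h.1 ?_ hsub hnd (fun x hx => hdis x (by simp [hx]))
          intro x hx
          rcases hcov x hx with hc | hc
          · exact Or.inl hc
          · right
            rcases List.mem_cons.1 hc with rfl | hc
            · exact absurd hx hp
            · exact hc

/-- All elements of `C_3^3`. -/
def points : List Pt :=
  [0, 1, 2].flatMap fun a => [0, 1, 2].flatMap fun b => [0, 1, 2].map fun c => (a, b, c)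

/-- The standard basis. -/
def basis : List Pt := [(1, 0, 0), (0, 1, 0), (0, 0, 1)]

/-- The points that can extend the standard basis to a larger cap. -/
def free : List Pt :=
  points.filter fun r => decide (r ≠ 0 ∧ ∀ p ∈ basis, r ≠ p ∧ r + p ≠ 0 ∧
    ∀ q ∈ basis, p ≠ q → r + p + q ≠ 0)

set_option maxRecDepth 100000 in
theorem search_free : search 30 free basis = true := by
  decide +kernel

end CapSearch

/-- A cap of at least seven elements in `C_3^3` has seven elements and nonzero sum,
or is one of the eight-element caps. -/
theorem CapSearch.isQuadric_of_basis_mem {X : Finset CapSearch.Pt} (hX : IsCap X)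
    (h7 : 7 ≤ X.card) (hb : ∀ x ∈ CapSearch.basis, x ∈ X) :
    (X.card = 7 ∧ ∑ x ∈ X, x ≠ 0) ∨ IsQuadric X := by
  have hall : ∀ x : CapSearch.Pt, x ∈ CapSearch.points := by
    decide
  obtain ⟨c, hnd, hc, hl⟩ := CapSearch.exists_leaf_of_search hX h7 30 _ _
    CapSearch.search_free (fun x hx => by
      by_cases hxb : x ∈ CapSearch.basis
      · exact Or.inl hxb
      · right
        simp only [CapSearch.free, List.mem_filter, hall x, true_and, decide_eq_true_eq]
        refine ⟨fun h => hX.zero_notMem (h ▸ hx), fun p hp => ⟨fun h => hxb (h ▸ hp), fun h => ?_,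
          fun q hq hpq h => ?_⟩⟩
        · exact hX.neg_notMem p (hb p hp) (by rwa [← eq_neg_of_add_eq_zero_left h])
        · refine hX.neg_add_notMem p (hb p hp) q (hb q hq) hpq ?_
          rwa [← eq_neg_of_add_eq_zero_left (by rwa [← add_assoc] : x + (p + q) = 0)])
    hb (by decide) (by
      intro x hx hxb
      simp only [CapSearch.free, List.mem_filter, decide_eq_true_eq] at hx
      exact (hx.2.2 x hxb).1 rfl)
  have hXc : X = c.toFinset := by ext x; simp [hc]
  have hcard : X.card = c.length := by rw [hXc, List.toFinset_card_of_nodup hnd]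
  have hsum : ∑ x ∈ X, x = c.sum := by
    rw [hXc, List.sum_toFinset _ hnd]; simp
  rcases hl with ⟨h1, h2⟩ | ⟨h1, h2, h3, h4⟩
  · left; rw [hcard, hsum]; exact ⟨h1, h2⟩
  · right
    simp only [hc] at h3 h4
    exact ⟨hcard.trans h1, hsum.trans h2, h3, h4⟩

theorem IsCap.of_map {E F : Type*} [AddCommGroup E] [AddCommGroup F] (e : E ≃+ F) {X : Finset E}
    (h : IsCap (X.map e.toEquiv.toEmbedding)) : IsCap X := by
  have key : ∀ x, e x ∈ X.map e.toEquiv.toEmbedding ↔ x ∈ X := fun x => by simp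
  refine ⟨fun h0 => h.zero_notMem ?_, fun x hx hn => h.neg_notMem (e x) ((key x).2 hx) ?_,
    fun x hx y hy hxy hn => h.neg_add_notMem (e x) ((key x).2 hx) (e y) ((key y).2 hy)
      (fun h => hxy (e.injective h)) ?_⟩
  · rw [← map_zero e]; exact (key 0).2 h0
  · rw [← map_neg]; exact (key _).2 hn
  · rw [← map_add, ← map_neg]; exact (key _).2 hn

theorem IsQuadric.map {E F : Type*} [AddCommGroup E] [AddCommGroup F] (e : E ≃+ F) {X : Finset E}
    (h : IsQuadric X) : IsQuadric (X.map e.toEquiv.toEmbedding) := by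
  have key : ∀ P : F → Prop, (∀ y ∈ X.map e.toEquiv.toEmbedding, P y) ↔ ∀ x ∈ X, P (e x) := by
    intro P
    simp only [Finset.mem_map, forall_exists_index, and_imp, forall_apply_eq_imp_iff₂]
    rfl
  have hmem : ∀ x ∈ X, e x ∈ X.map e.toEquiv.toEmbedding := fun x hx => by simpa using hx
  refine ⟨by simp [h.card_eq], ?_, ?_, ?_⟩
  · have := congrArg e h.sum_eq
    simpa using this
  · rw [key]
    intro p hp
    obtain ⟨a, ha, b, hb, h1, h2, h3, h4⟩ := h.eq_add p hp
    exact ⟨e a, hmem a ha, e b, hmem b hb, e.injective.ne h1, e.injective.ne h2, e.injective.ne h3,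
      by rw [h4, map_add]⟩
  · rw [key]
    intro p hp
    rw [key]
    intro q hq hpq
    obtain ⟨a, ha, b, hb, ⟨h1, h2, h3, h4⟩, h5⟩ := h.add_eq p hp q hq (fun h => hpq (h ▸ rfl))
    refine ⟨e a, hmem a ha, e b, hmem b hb, ⟨e.injective.ne h1, e.injective.ne h2,
      e.injective.ne h3, e.injective.ne h4⟩, ?_⟩
    rcases h5 with h5 | ⟨h5, h6⟩
    · left; rw [h5, map_add]
    · right; exact ⟨e.injective.ne h5, by rw [← map_add, h6, map_add]⟩

/-- The group `C_3^3`. -/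
abbrev F3 := Fin 3 → ZMod 3

/-- The linear map with the given images of the standard basis vectors. -/
def combHom (x y z : F3) : CapSearch.Pt →+ F3 where
  toFun p := p.1 • x + p.2.1 • y + p.2.2 • z
  map_zero' := by simp
  map_add' p q := by simp only [Prod.fst_add, Prod.snd_add, add_smul]; abel

theorem F3.three_nsmul (x : F3) : x + x + x = 0 := by
  revert x; decide

theorem IsCap.combHom_injective {X : Finset F3} (hX : IsCap X) {x y z : F3} (hx : x ∈ X)
    (hy : y ∈ X) (hz : z ∈ X) (hxy : x ≠ y) (h1 : z ≠ x) (h2 : z ≠ y) (h3 : z ≠ x + y)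
    (h4 : z ≠ x - y) (h5 : z ≠ y - x) : Function.Injective (combHom x y z) := by
  rw [injective_iff_map_eq_zero]
  rintro ⟨a, b, c⟩ h
  have hx0 : x ≠ 0 := fun h => hX.zero_notMem (h ▸ hx)
  have hy0 : y ≠ 0 := fun h => hX.zero_notMem (h ▸ hy)
  have hz0 : z ≠ 0 := fun h => hX.zero_notMem (h ▸ hz)
  have n1 := hX.neg_notMem x hx
  have n2 := hX.neg_notMem y hy
  have n3 := hX.neg_add_notMem x hx y hy hxy
  have m1 : x ≠ -y := fun h => n2 (h ▸ hx)
  have m2 : z ≠ -x := fun h => n1 (h ▸ hz)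
  have m3 : z ≠ -y := fun h => n2 (h ▸ hz)
  have m4 : z ≠ -(x + y) := fun h => n3 (h ▸ hz)
  have h : a • x + b • y + c • z = 0 := h
  clear n1 n2 n3 hX hx hy hz
  have h0 : ∀ a : ZMod 3, a = 0 ∨ a = 1 ∨ a = -1 := by decide
  rcases h0 a with rfl | rfl | rfl <;> rcases h0 b with rfl | rfl | rfl <;>
    rcases h0 c with rfl | rfl | rfl <;>
    simp only [zero_smul, one_smul, neg_smul, zero_add, add_zero] at h <;>
    first
    | rfl
    | (exfalso; grind)

theorem IsCap.isQuadric {X : Finset F3} (hX : IsCap X) (h7 : 7 ≤ X.card) :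
    (X.card = 7 ∧ ∑ x ∈ X, x ≠ 0) ∨ IsQuadric X := by
  obtain ⟨x, hx, y, hy, hxy⟩ := Finset.one_lt_card.1 (show 1 < X.card by omega)
  obtain ⟨z, hz, hzn⟩ := Finset.exists_mem_notMem_of_card_lt_card
    (s := {x, y, x + y, x - y, y - x}) (t := X) (lt_of_le_of_lt Finset.card_le_five (by omega))
  simp only [Finset.mem_insert, Finset.mem_singleton, not_or] at hzn
  have hinj := hX.combHom_injective hx hy hz hxy hzn.1 hzn.2.1 hzn.2.2.1 hzn.2.2.2.1 hzn.2.2.2.2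
  have hbij : Function.Bijective (combHom x y z) :=
    (Fintype.bijective_iff_injective_and_card _).2 ⟨hinj, by simp⟩
  let e : CapSearch.Pt ≃+ F3 := AddEquiv.ofBijective (combHom x y z) hbij
  have hmap : (X.map e.symm.toEquiv.toEmbedding).map e.toEquiv.toEmbedding = X := by
    ext p; simp
  have he : ∀ p, e p = p.1 • x + p.2.1 • y + p.2.2 • z := fun _ => rfl
  have hcard : (X.map e.symm.toEquiv.toEmbedding).card = X.card := by simp
  rcases CapSearch.isQuadric_of_basis_mem (IsCap.of_map e (by rwa [hmap])) (by rwa [hcard]) (by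
    simp only [CapSearch.basis, List.mem_cons, List.not_mem_nil, or_false]
    rintro p (rfl | rfl | rfl)
    all_goals
      rw [Finset.mem_map]
    · exact ⟨x, hx, e.symm_apply_eq.2 (by simp [he])⟩
    · exact ⟨y, hy, e.symm_apply_eq.2 (by simp [he])⟩
    · exact ⟨z, hz, e.symm_apply_eq.2 (by simp [he])⟩) with ⟨h1, h2⟩ | h
  · left
    refine ⟨hcard ▸ h1, fun h => h2 ?_⟩
    have := congrArg e.symm h
    simpa using this
  · right
    have := h.map e
    rwa [hmap] at this

theorem Multiset.exists_le_map_eq {α β : Type*} {f : α → β} {S : Multiset α} {U : Multiset β}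
    (h : U ≤ S.map f) : ∃ T ≤ S, T.map f = U := by
  induction S using Quotient.inductionOn with
  | h l =>
    induction U using Quotient.inductionOn with
    | h u =>
      obtain ⟨u', hp, hs⟩ := Multiset.coe_le.1 h
      obtain ⟨l', hl, rfl⟩ := List.sublist_map_iff.1 hs
      exact ⟨l', Multiset.coe_le.2 hl.subperm, Multiset.coe_eq_coe.2 hp⟩

theorem Multiset.exists_le_card_eq {α : Type*} {S : Multiset α} {n : ℕ} (h : n ≤ S.card) :
    ∃ T ≤ S, T.card = n := by
  induction S using Quotient.inductionOn with
  | h l =>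
    exact ⟨(l.take n : List α), Multiset.coe_le.2 (List.take_sublist n l).subperm,
      by simpa using h⟩

/-- `S` has a nonempty subsequence of length at most `N` whose sum is divisible by `d`. -/
def HasShortDvdSum {V : Type*} [AddCommGroup V] (d N : ℕ) (S : Multiset V) : Prop :=
  ∃ T ≤ S, T ≠ 0 ∧ T.card ≤ N ∧ ∃ w, T.sum = d • w

/-- A family of pairs `(B, w)`, where `B` is a nonempty sequence of length at most `N`
with sum `d • w`. -/
def IsPacking {V : Type*} [AddCommGroup V] (d N : ℕ) (P : Multiset (Multiset V × V)) : Prop :=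
  ∀ b ∈ P, b.1 ≠ 0 ∧ b.1.card ≤ N ∧ b.1.sum = d • b.2

/-- `Q` has no nonempty zero-sum subsequence of length at most `N`. -/
def IsShortFree {F : Type*} [AddCommGroup F] (N : ℕ) (Q : Multiset F) : Prop :=
  ∀ C ≤ Q, C ≠ 0 → C.card ≤ N → C.sum ≠ 0

section Packing

variable {V F : Type*} [AddCommGroup V] [AddCommGroup F]

theorem HasShortDvdSum.mono {d N : ℕ} {S T : Multiset V} (h : HasShortDvdSum d N S) (hST : S ≤ T) :
    HasShortDvdSum d N T := by
  obtain ⟨U, hU, h⟩ := h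
  exact ⟨U, hU.trans hST, h⟩

theorem IsPacking.mono {d N : ℕ} {P Q : Multiset (Multiset V × V)} (h : IsPacking d N P)
    (hQ : Q ≤ P) : IsPacking d N Q :=
  fun b hb => h b (Multiset.mem_of_le hQ hb)

theorem IsPacking.cons {d N : ℕ} {P : Multiset (Multiset V × V)} (h : IsPacking d N P)
    {B : Multiset V} {w : V} (h0 : B ≠ 0) (hN : B.card ≤ N) (hw : B.sum = d • w) :
    IsPacking d N ((B, w) ::ₘ P) := by
  intro b hb
  rcases Multiset.mem_cons.1 hb with rfl | hb
  · exact ⟨h0, hN, hw⟩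
  · exact h b hb

theorem IsPacking.sum_sum {d N : ℕ} {P : Multiset (Multiset V × V)} (h : IsPacking d N P) :
    (P.map Prod.fst).sum.sum = d • (P.map Prod.snd).sum := by
  induction P using Multiset.induction_on with
  | empty => simp
  | cons b P ih =>
    simp [ih (h.mono (Multiset.le_cons_self _ _)), (h b (Multiset.mem_cons_self _ _)).2.2]

theorem IsPacking.card_sum_le {d N : ℕ} {P : Multiset (Multiset V × V)} (h : IsPacking d N P) :
    (P.map Prod.fst).sum.card ≤ N * P.card := by
  induction P using Multiset.induction_on with
  | empty => simp
  | cons b P ih =>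
    have h1 := ih (h.mono (Multiset.le_cons_self _ _))
    have h2 := (h b (Multiset.mem_cons_self _ _)).2.1
    simp only [Multiset.map_cons, Multiset.sum_cons, Multiset.card_add, Multiset.card_cons, mul_add]
    omega

theorem IsPacking.sum_ne_zero {d N : ℕ} {P : Multiset (Multiset V × V)} (h : IsPacking d N P)
    (hP : P ≠ 0) : (P.map Prod.fst).sum ≠ 0 := by
  obtain ⟨b, hb⟩ := Multiset.exists_mem_of_ne_zero hP
  intro h0
  have := Multiset.le_sum_of_mem (Multiset.mem_map_of_mem Prod.fst hb)
  rw [h0] at this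
  exact (h b hb).1 (Multiset.le_zero.1 this)

theorem Multiset.sum_map_le_sum_map_of_le {α β : Type*} {f : α → Multiset β} {S T : Multiset α}
    (h : S ≤ T) : (S.map f).sum ≤ (T.map f).sum := by
  obtain ⟨U, rfl⟩ := Multiset.le_iff_exists_add.1 h
  simp

theorem IsPacking.hasShortDvdSum {d N m M : ℕ} {P : Multiset (Multiset V × V)}
    (hP : IsPacking d N P) (h : HasShortDvdSum m M (P.map Prod.snd)) :
    HasShortDvdSum (d * m) (N * M) (P.map Prod.fst).sum := by
  obtain ⟨U, hU, hU0, hUM, w, hw⟩ := h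
  obtain ⟨Q, hQ, rfl⟩ := Multiset.exists_le_map_eq hU
  refine ⟨_, Multiset.sum_map_le_sum_map_of_le hQ, (hP.mono hQ).sum_ne_zero ?_, ?_, w, ?_⟩
  · rintro rfl; exact hU0 rfl
  · refine (hP.mono hQ).card_sum_le.trans (Nat.mul_le_mul_left _ ?_)
    simpa using hUM
  · rw [(hP.mono hQ).sum_sum, hw, mul_nsmul']

theorem IsPacking.comp {d N m M : ℕ} {P Q : Multiset (Multiset V × V)} (hP : IsPacking d N P)
    (hQ : IsPacking m M Q) (h : (Q.map Prod.fst).sum ≤ P.map Prod.snd) :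
    ∃ Q', IsPacking (d * m) (N * M) Q' ∧ Q'.map Prod.snd = Q.map Prod.snd ∧
      (Q'.map Prod.fst).sum ≤ (P.map Prod.fst).sum := by
  induction Q using Multiset.induction_on generalizing P with
  | empty => exact ⟨0, by simp [IsPacking], rfl, by simp⟩
  | cons b Q ih =>
    obtain ⟨h0, hM, hw⟩ := hQ b (Multiset.mem_cons_self _ _)
    rw [Multiset.map_cons, Multiset.sum_cons] at h
    obtain ⟨P1, hP1, h1⟩ := Multiset.exists_le_map_eq ((Multiset.le_add_right _ _).trans h)
    obtain ⟨P2, rfl⟩ := Multiset.le_iff_exists_add.1 hP1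
    rw [Multiset.map_add, h1] at h
    obtain ⟨Q', hQ', h2, h3⟩ := ih (hP.mono (Multiset.le_add_left P2 P1))
      (hQ.mono (Multiset.le_cons_self _ _)) ((add_le_add_iff_left _).1 h)
    refine ⟨((P1.map Prod.fst).sum, b.2) ::ₘ Q', hQ'.cons ?_ ?_ ?_, by simp [h2], ?_⟩
    · refine (hP.mono hP1).sum_ne_zero ?_
      rintro rfl; exact h0 h1.symm
    · refine (hP.mono hP1).card_sum_le.trans (Nat.mul_le_mul_left _ ?_)
      rw [← h1] at hM
      simpa using hM
    · rw [(hP.mono hP1).sum_sum, h1, hw, mul_nsmul']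
    · simp [h3]

/-- The kernel of `φ` consists of multiples of `d`. -/
def KerDvd (d : ℕ) (φ : V →+ F) : Prop := ∀ v, φ v = 0 → ∃ w, v = d • w

theorem map_multiset_sum_eq (φ : V →+ F) (S : Multiset V) : φ S.sum = (S.map φ).sum :=
  map_multiset_sum φ S

/-- Splitting off blocks with divisible sums as long as possible. -/
theorem exists_isPacking_add_eq {d : ℕ} {φ : V →+ F} (hφ : KerDvd d φ) (N : ℕ) (S : Multiset V) :
    ∃ P R, IsPacking d N P ∧ (P.map Prod.fst).sum + R = S ∧ IsShortFree N (R.map φ) := by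
  induction S using Multiset.strongInductionOn with
  | ih S ih =>
    by_cases hS : IsShortFree N (S.map φ)
    · exact ⟨0, S, by simp [IsPacking], by simp, hS⟩
    · simp only [IsShortFree, not_forall, not_not] at hS
      obtain ⟨C, hC, h0, hN, hs⟩ := hS
      obtain ⟨B, hB, rfl⟩ := Multiset.exists_le_map_eq hC
      obtain ⟨S', rfl⟩ := Multiset.le_iff_exists_add.1 hB
      have hB0 : B ≠ 0 := by rintro rfl; exact h0 rfl
      obtain ⟨w, hw⟩ := hφ B.sum (by rw [map_multiset_sum_eq, hs])
      obtain ⟨P, R, hP, rfl, hR⟩ := ih S' (lt_of_le_of_ne (Multiset.le_add_left _ _)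
        (by simpa using hB0))
      exact ⟨(B, w) ::ₘ P, R, hP.cons hB0 (by simpa using hN) hw, by simp [add_assoc], hR⟩

end Packing

/-- The group `C_2^3`. -/
abbrev F2 := Fin 3 → ZMod 2

theorem F2.add_self (x : F2) : x + x = 0 := by
  revert x; decide

section Two

variable {V : Type*} [AddCommGroup V]

theorem IsShortFree.nodup {Q : Multiset F2} (h : IsShortFree 2 Q) : Q.Nodup := by
  rw [Multiset.nodup_iff_le]
  intro x hx
  refine h _ hx (by simp) (by simp) ?_
  simpa using F2.add_self x

/-- Pairing elements of `S` with equal image in `C_2^3`, of which at most one per class in `A`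
remains. -/
theorem exists_pairs {φ : V →+ F2} (hφ : KerDvd 2 φ) (A : Finset F2) (S : Multiset V)
    (hA : ∀ s ∈ S, φ s ≠ 0 → φ s ∈ A) :
    ∃ P, IsPacking 2 2 P ∧ (P.map Prod.fst).sum ≤ S ∧ S.card ≤ 2 * P.card + A.card := by
  obtain ⟨P, R, hP, rfl, hR⟩ := exists_isPacking_add_eq hφ 2 S
  refine ⟨P, hP, Multiset.le_add_right _ _, ?_⟩
  have h1 := hP.card_sum_le
  have h2 : R.card ≤ A.card := by
    rw [← Multiset.card_map φ R, ← Multiset.toFinset_card_of_nodup hR.nodup]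
    refine Finset.card_le_card fun x hx => ?_
    have hx' : x ∈ R.map φ := by simpa using hx
    obtain ⟨r, hr, rfl⟩ := Multiset.mem_map.1 hx'
    refine hA r (by simp [hr]) fun h => ?_
    refine hR {φ r} (by simpa using hx) (by simp) (by simp) (by simpa using h)
  rw [Multiset.card_add]
  omega

/-- The seven nonzero elements of `C_2^3`. -/
def F2.nonzero : Finset F2 := Finset.univ.erase 0

theorem F2.card_nonzero : F2.nonzero.card = 7 := by
  simp [F2.nonzero]

theorem F2.mem_nonzero {x : F2} : x ∈ F2.nonzero ↔ x ≠ 0 := by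
  simp [F2.nonzero]

theorem exists_pairs_card_le {φ : V →+ F2} (hφ : KerDvd 2 φ) (S : Multiset V) :
    ∃ P, IsPacking 2 2 P ∧ (P.map Prod.fst).sum ≤ S ∧ S.card ≤ 2 * P.card + 7 := by
  obtain ⟨P, h⟩ := exists_pairs hφ F2.nonzero S fun s _ => F2.mem_nonzero.2
  exact ⟨P, by rwa [F2.card_nonzero] at h⟩

/-- `η(C_m^3) ≤ 7m - 6` for powers of two `m`. -/
theorem hasShortDvdSum_two_pow {φ : V →+ F2} (hφ : KerDvd 2 φ) (k : ℕ) :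
    ∀ T : Multiset V, 7 * 2 ^ k ≤ T.card + 6 → HasShortDvdSum (2 ^ k) (2 ^ k) T := by
  induction k with
  | zero =>
    intro T hT
    obtain ⟨x, hx⟩ := Multiset.card_pos_iff_exists_mem.1 (show 0 < T.card by omega)
    exact ⟨{x}, by simpa using hx, by simp, by simp, x, by simp⟩
  | succ k ih =>
    intro T hT
    obtain ⟨P, hP, hle, hc⟩ := exists_pairs_card_le hφ T
    rw [pow_succ'] at hT ⊢
    exact (hP.hasShortDvdSum (ih (P.map Prod.snd) (by rw [Multiset.card_map]; omega))).mono hle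

end Two

section Extremal

variable {V : Type*} [AddCommGroup V]

theorem exists_sum_sub_eq_nsmul {n : ℕ} {b : V} {U : Multiset V}
    (h : ∀ x ∈ U, ∃ w, x - b = n • w) : ∃ w, U.sum - U.card • b = n • w := by
  induction U using Multiset.induction_on with
  | empty => exact ⟨0, by simp⟩
  | cons x U ih =>
    obtain ⟨w, hw⟩ := ih fun y hy => h y (Multiset.mem_cons_of_mem hy)
    obtain ⟨u, hu⟩ := h x (Multiset.mem_cons_self _ _)
    refine ⟨u + w, ?_⟩
    rw [nsmul_add, ← hw, ← hu, Multiset.sum_cons, Multiset.card_cons, succ_nsmul]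
    abel

theorem hasShortDvdSum_of_congr {n : ℕ} (hn : n ≠ 0) {S U : Multiset V} (hU : U ≤ S)
    (hc : n ≤ U.card) (h : ∀ x ∈ U, ∀ y ∈ U, ∃ w, x - y = n • w) : HasShortDvdSum n n S := by
  obtain ⟨U', hU', hc'⟩ := Multiset.exists_le_card_eq hc
  have h0 : U' ≠ 0 := by rintro rfl; exact hn (by simpa using hc'.symm)
  obtain ⟨b, hb⟩ := Multiset.exists_mem_of_ne_zero h0
  obtain ⟨w, hw⟩ := exists_sum_sub_eq_nsmul (n := n) (b := b) (U := U') fun x hx =>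
    h x (Multiset.mem_of_le hU' hx) b (Multiset.mem_of_le hU' hb)
  refine ⟨U', hU'.trans hU, h0, hc'.le, b + w, ?_⟩
  rw [hc', sub_eq_iff_eq_add'] at hw
  rw [hw, nsmul_add]

theorem hasShortDvdSum_of_packing {φ : V →+ F2} (hφ : KerDvd 2 φ) {d N k : ℕ}
    {P : Multiset (Multiset V × V)} (hP : IsPacking d N P) (hc : 7 * 2 ^ k ≤ P.card + 6)
    {S : Multiset V} (hS : (P.map Prod.fst).sum ≤ S) :
    HasShortDvdSum (d * 2 ^ k) (N * 2 ^ k) S :=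
  (hP.hasShortDvdSum (hasShortDvdSum_two_pow hφ k _ (by simpa using hc))).mono hS

/-- A sequence of length `7m - 7` without short zero-sum subsequence modulo `m`, where `m` is a
power of two, consists of `m - 1` terms in each nonzero class modulo two, and the terms of each
class are congruent modulo `m`. -/
theorem extremal_structure {φ : V →+ F2} (hφ : KerDvd 2 φ) (k : ℕ) :
    ∀ T : Multiset V, T.card + 7 = 7 * 2 ^ k → ¬ HasShortDvdSum (2 ^ k) (2 ^ k) T →
      (∀ b ∈ T, φ b ≠ 0) ∧ (∀ b ∈ T, ∀ c ∈ T, φ b = φ c → ∃ w, b - c = 2 ^ k • w) ∧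
        ∀ v ≠ 0, (T.map φ).count v + 1 = 2 ^ k := by
  induction k with
  | zero =>
    intro T hT _
    obtain rfl : T = 0 := Multiset.card_eq_zero.1 (by omega)
    simp
  | succ k ih =>
    intro T hT hno
    have hm : 0 < 2 ^ k := by positivity
    rw [pow_succ'] at hT hno ⊢
    set m := 2 ^ k with hmdef
    have hit : ∀ P, IsPacking 2 2 P → (P.map Prod.fst).sum ≤ T → ¬ 7 * m ≤ P.card + 6 :=
      fun P hP hle hc => hno (hasShortDvdSum_of_packing hφ hP hc hle)
    have h1 : ∀ b ∈ T, φ b ≠ 0 := by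
      intro b hb h0
      obtain ⟨T', rfl⟩ := Multiset.exists_cons_of_mem hb
      obtain ⟨w, hw⟩ := hφ b h0
      obtain ⟨P, hP, hle, hc⟩ := exists_pairs_card_le hφ T'
      rw [Multiset.card_cons] at hT
      refine hit (({b}, w) ::ₘ P) (hP.cons (by simp) (by simp) (by simpa using hw)) ?_ ?_
      · simpa using hle
      · rw [Multiset.card_cons]; omega
    have h2 : ∀ b ∈ T, ∀ c ∈ T, φ b = φ c → ∃ w, b - c = (2 * m) • w := by
      intro b hb b' hb' hbb
      by_cases hne : b = b'
      · exact ⟨0, by simp [hne]⟩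
      have hv := h1 b hb
      obtain ⟨T', hT'⟩ := Multiset.exists_cons_of_mem hb
      have hb'' : b' ∈ T' := by
        rw [hT'] at hb'
        exact (Multiset.mem_cons.1 hb').resolve_left (Ne.symm hne)
      obtain ⟨T0, rfl⟩ := Multiset.exists_cons_of_mem hb''
      have hcT : T0.card + 9 = 7 * (2 * m) := by rw [hT'] at hT; simpa using hT
      have pair : ∀ x y, φ x = φ y → ∃ w, ({x, y} : Multiset V).sum = 2 • w := by
        intro x y hxy
        refine hφ _ ?_
        simpa [hxy] using F2.add_self (φ y)
      by_cases hex : ∃ c ∈ T0, φ c = φ b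
      · obtain ⟨c, hc, hcb⟩ := hex
        obtain ⟨T1, rfl⟩ := Multiset.exists_cons_of_mem hc
        obtain ⟨P, hP, hle, hcard⟩ := exists_pairs_card_le hφ T1
        rw [Multiset.card_cons] at hcT
        obtain ⟨w, hw⟩ := pair b c hcb.symm
        obtain ⟨w', hw'⟩ := pair b' c (hbb.symm.trans hcb.symm)
        have hQ := hP.cons (B := {b, c}) (w := w) (by simp) (by simp) hw
        have hQ' := hP.cons (B := {b', c}) (w := w') (by simp) (by simp) hw'
        have hQle : ((({b, c}, w) ::ₘ P).map Prod.fst).sum ≤ T := by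
          rw [hT', Multiset.cons_swap b']
          simpa [← Multiset.singleton_add, add_assoc] using hle.trans (Multiset.le_cons_self _ _)
        have hQle' : ((({b', c}, w') ::ₘ P).map Prod.fst).sum ≤ T := by
          rw [hT']
          refine le_trans ?_ (Multiset.le_cons_self _ _)
          simpa [← Multiset.singleton_add, add_assoc] using hle
        have hc1 := hit _ hQ hQle
        rw [Multiset.card_cons] at hc1
        have hbb' : b - b' = 2 • (w - w') := by
          rw [nsmul_sub, ← hw, ← hw']
          simp
        obtain ⟨a1, a2, a3⟩ := ih ((({b, c}, w) ::ₘ P).map Prod.snd)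
          (by rw [Multiset.card_map, Multiset.card_cons]; omega)
          fun h => hno ((hQ.hasShortDvdSum h).mono hQle)
        obtain ⟨b1, b2, b3⟩ := ih ((({b', c}, w') ::ₘ P).map Prod.snd)
          (by rw [Multiset.card_map, Multiset.card_cons]; omega)
          fun h => hno ((hQ'.hasShortDvdSum h).mono hQle')
        simp only [Multiset.map_cons] at a1 a2 a3 b1 b2 b3
        have hww : φ w = φ w' := by
          have e1 := a3 (φ w) (a1 w (by simp))
          have e2 := b3 (φ w) (a1 w (by simp))
          by_contra! hcon
          rw [Multiset.count_cons_self] at e1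
          rw [Multiset.count_cons_of_ne hcon] at e2
          omega
        suffices h : ∃ u, w - w' = m • u by
          obtain ⟨u, hu⟩ := h
          exact ⟨u, by rw [hbb', hu, mul_nsmul']⟩
        by_cases hex : ∃ x ∈ P.map Prod.snd, φ x = φ w
        · obtain ⟨x, hx, hxw⟩ := hex
          obtain ⟨u, hu⟩ := a2 w (by simp) x (Multiset.mem_cons_of_mem hx) hxw.symm
          obtain ⟨u', hu'⟩ := b2 w' (by simp) x (Multiset.mem_cons_of_mem hx)
            (hww.symm.trans hxw.symm)
          exact ⟨u - u', by rw [nsmul_sub, ← hu, ← hu']; abel⟩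
        · have e1 := a3 (φ w) (a1 w (by simp))
          rw [Multiset.count_cons_self, Multiset.count_eq_zero.2 (fun h => hex (by
            simpa only [Multiset.mem_map] using h))] at e1
          rw [← e1]
          exact hφ _ (by rw [map_sub, hww, sub_self])
      · exfalso
        push Not at hex
        obtain ⟨P, hP, hle, hcard⟩ := exists_pairs hφ (F2.nonzero.erase (φ b)) T0 fun s hs h0 =>
          Finset.mem_erase.2 ⟨hex s hs, F2.mem_nonzero.2 h0⟩
        rw [Finset.card_erase_of_mem (F2.mem_nonzero.2 hv), F2.card_nonzero] at hcard
        obtain ⟨w, hw⟩ := pair b b' hbb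
        refine hit (({b, b'}, w) ::ₘ P) (hP.cons (by simp) (by simp) hw) ?_ ?_
        · rw [hT']
          simpa [← Multiset.singleton_add, add_assoc] using hle
        · rw [Multiset.card_cons]; omega
    refine ⟨h1, h2, ?_⟩
    have hlt : ∀ v ∈ F2.nonzero, (T.map φ).count v ≤ 2 * m - 1 := by
      intro v _
      by_contra! hcon
      refine hno (hasShortDvdSum_of_congr (by omega) (Multiset.filter_le (fun b => v = φ b) T)
        ?_ ?_)
      · rw [Multiset.count_map] at hcon
        omega
      · intro x hx y hy
        rw [Multiset.mem_filter] at hx hy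
        exact h2 x hx.1 y hy.1 (hx.2.symm.trans hy.2)
    have hsum : ∑ v ∈ F2.nonzero, (T.map φ).count v = ∑ v ∈ F2.nonzero, (2 * m - 1) := by
      rw [Multiset.sum_count_eq_card fun a ha => ?_, Multiset.card_map, Finset.sum_const,
        F2.card_nonzero, smul_eq_mul]
      · omega
      · obtain ⟨b, hb, rfl⟩ := Multiset.mem_map.1 ha
        exact F2.mem_nonzero.2 (h1 b hb)
    intro v hv
    have := (Finset.sum_eq_sum_iff_of_le hlt).1 hsum v (F2.mem_nonzero.2 hv)
    omega

end Extremal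

section Three

theorem F3.eq_of_add_add_eq_zero {x y : F3} (h : x + x + y = 0) : y = x :=
  add_left_cancel (h.trans (F3.three_nsmul x).symm)

theorem F3.eq_zero_of_add_self {x : F3} (h : x + x = 0) : x = 0 := by
  simpa [h] using F3.three_nsmul x

theorem F3.eq_zero_of_eq_neg {x : F3} (h : x = -x) : x = 0 :=
  F3.eq_zero_of_add_self (eq_neg_iff_add_eq_zero.1 h)

theorem Finset.sum_val_add_val {X : Finset F3} :
    (X.val + X.val).sum = ∑ x ∈ X, x + ∑ x ∈ X, x := by
  rw [Multiset.sum_add, Finset.sum_eq_multiset_sum, Multiset.map_id']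

theorem IsShortFree.isCap {R : Multiset F3} (h : IsShortFree 3 R) : IsCap R.toFinset := by
  have h0 : (0 : F3) ∉ R := fun h0 => h {0} (by simpa using h0) (by simp) (by simp) (by simp)
  simp only [isCap_iff, Multiset.mem_toFinset]
  refine ⟨h0, fun x hx hn => ?_, fun x hx y hy hxy hn => ?_⟩
  · refine h {x, -x} ((Multiset.le_iff_subset ?_).2 ?_) (by simp) (by simp) (by simp)
    · simp only [Multiset.insert_eq_cons, Multiset.nodup_cons, Multiset.mem_singleton,
        Multiset.nodup_singleton, and_true]
      exact fun e => h0 (F3.eq_zero_of_eq_neg e ▸ hx)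
    · simp [Multiset.subset_iff, hx, hn]
  · refine h {x, y, -(x + y)} ((Multiset.le_iff_subset ?_).2 ?_) (by simp) (by simp) ?_
    · simp only [Multiset.insert_eq_cons, Multiset.nodup_cons, Multiset.mem_cons,
        Multiset.mem_singleton, Multiset.nodup_singleton, and_true, not_or]
      refine ⟨⟨hxy, fun e => hxy (F3.eq_of_add_add_eq_zero ?_).symm⟩,
        fun e => hxy (F3.eq_of_add_add_eq_zero ?_)⟩
      · rw [eq_neg_iff_add_eq_zero] at e; rwa [← add_assoc] at e
      · rw [eq_neg_iff_add_eq_zero] at e; rw [← e]; abel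
    · simpa [Multiset.subset_iff, hx, hy] using hn
    · simp

theorem IsCap.neg_ne {X : Finset F3} (hX : IsCap X) {x y : F3} (hx : x ∈ X) (hy : y ∈ X) :
    x + y ≠ 0 := by
  intro h
  exact hX.neg_notMem x hx (by rwa [neg_eq_of_add_eq_zero_right h])

/-- Zero-sum sequences of length at least `14` over `C_3^3` without short zero-sum subsequence
are squares of eight-element caps. -/
theorem IsShortFree.exists_eq_two_cap {R : Multiset F3} (h : IsShortFree 3 R) (h0 : R.sum = 0)
    (hc : 14 ≤ R.card) : ∃ X : Finset F3, IsCap X ∧ IsQuadric X ∧ R = X.val + X.val := by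
  have hcap := h.isCap
  set X := R.toFinset with hXdef
  have hle : R ≤ X.val + X.val := by
    refine Multiset.le_iff_count.2 fun x => ?_
    by_cases hx : x ∈ R
    · have h1 : Multiset.count x X.val = 1 :=
        Multiset.count_eq_one_of_mem X.nodup (by simpa [hXdef] using hx)
      rw [Multiset.count_add, h1]
      by_contra! hcon
      refine h (Multiset.replicate 3 x) (Multiset.le_count_iff_replicate_le.1 hcon) (by simp)
        (by simp) ?_
      simpa [Multiset.replicate_succ, add_assoc] using F3.three_nsmul x
    · rw [Multiset.count_eq_zero_of_notMem hx]
      exact Nat.zero_le _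
  have hcard := Multiset.card_le_card hle
  have hX2 : (X.val + X.val).card = 2 * X.card := by
    rw [Multiset.card_add, Finset.card_val]; ring
  rcases hcap.isQuadric (by omega) with ⟨h7, hs⟩ | hq
  · exfalso
    have := Multiset.eq_of_le_of_card_le hle (by omega)
    rw [this, Finset.sum_val_add_val] at h0
    exact hs (F3.eq_zero_of_add_self h0)
  · refine ⟨X, hcap, hq, ?_⟩
    obtain ⟨D, hD⟩ := Multiset.le_iff_exists_add.1 hle
    have hDX : ∀ d ∈ D, d ∈ X := by
      intro d hd
      have : d ∈ X.val + X.val := by rw [hD]; exact Multiset.mem_add.2 (Or.inr hd)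
      simpa using this
    have hDs : D.sum = 0 := by
      have := congrArg Multiset.sum hD
      rwa [Finset.sum_val_add_val, hq.sum_eq, Multiset.sum_add, h0, zero_add, zero_add,
        eq_comm] at this
    have hDc : D.card ≤ 2 := by
      have := congrArg Multiset.card hD
      rw [hX2, Multiset.card_add, hq.card_eq] at this
      omega
    have : D = 0 := by
      rw [← Multiset.card_eq_zero]
      by_contra hne
      have : D.card = 1 ∨ D.card = 2 := by omega
      rcases this with h1 | h2
      · obtain ⟨d, rfl⟩ := Multiset.card_eq_one.1 h1
        exact hcap.zero_notMem (by simpa using (by simpa using hDs : d = 0) ▸ hDX d (by simp))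
      · obtain ⟨d, e, rfl⟩ := Multiset.card_eq_two.1 h2
        exact hcap.neg_ne (hDX d (by simp)) (hDX e (by simp)) (by simpa using hDs)
    rw [hD, this, add_zero]

/-- The eight-element caps are complete. -/
theorem IsCap.exists_add_add_eq_zero {X : Finset F3} (hX : IsCap X) (h8 : X.card = 8) {g : F3}
    (hg : g ∉ X) (hg0 : g ≠ 0) (hgn : -g ∉ X) : ∃ x ∈ X, ∃ y ∈ X, x ≠ y ∧ g + x + y = 0 := by
  by_contra! hcon
  have key : ∀ x ∈ X, ∀ y ∈ X, g + x + y ≠ 0 := by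
    intro x hx y hy h
    by_cases hxy : x = y
    · subst hxy
      have : g = x := F3.eq_of_add_add_eq_zero (by rw [← h]; abel)
      exact hg (this ▸ hx)
    · exact hcon x hx y hy hxy h
  have hcap : IsCap (insert g X) := by
    simp only [isCap_iff, Finset.mem_insert]
    refine ⟨by simpa [hg0.symm] using hX.zero_notMem, ?_, ?_⟩
    · rintro x (rfl | hx) (h | h)
      · exact hg0 (F3.eq_zero_of_eq_neg h.symm)
      · exact hgn h
      · exact hgn (by rwa [← h, neg_neg])
      · exact hX.neg_notMem x hx h
    · have aux : ∀ y ∈ X, ¬ (-(g + y) = g ∨ -(g + y) ∈ X) := by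
        rintro y hy (h | h)
        · rw [neg_eq_iff_add_eq_zero] at h
          have : y = g := F3.eq_of_add_add_eq_zero (by rw [← h]; abel)
          exact hg (this ▸ hy)
        · exact key y hy _ h (by abel)
      rintro x (rfl | hx) y (rfl | hy) hxy h
      · exact hxy rfl
      · exact aux y hy h
      · exact aux x hx (by rwa [add_comm] at h)
      · rcases h with h | h
        · exact key x hx y hy (by rw [← h]; abel)
        · exact hX.neg_add_notMem x hx y hy hxy h
  have h9 : (insert g X).card = 9 := by rw [Finset.card_insert_of_notMem hg, h8]
  rcases hcap.isQuadric (by omega) with h | h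
  · omega
  · have := h.card_eq
    omega

/-- A zero-sum block of length three together with the square of an eight-element cap contains
two disjoint short zero-sum subsequences, unless the block is a triple point of the cap. -/
theorem IsCap.exchange {X : Finset F3} (hX : IsCap X) (hq : IsQuadric X) {B : Multiset F3}
    (hB : B.card = 3) (hB0 : B.sum = 0) :
    (∃ x ∈ X, B = {x, x, x}) ∨ ∃ C₁ C₂ : Multiset F3, (C₁ ≠ 0 ∧ C₁.card ≤ 3 ∧ C₁.sum = 0) ∧
      (C₂ ≠ 0 ∧ C₂.card ≤ 3 ∧ C₂.sum = 0) ∧ C₁ + C₂ ≤ B + (X.val + X.val) := by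
  by_cases hall : ∀ g ∈ B, g ∈ X
  · left
    obtain ⟨a, b, c, rfl⟩ := Multiset.card_eq_three.1 hB
    have hs : a + b + c = 0 := by simpa [add_assoc] using hB0
    have hab : a = b := by
      by_contra hab
      refine hX.neg_add_notMem a (hall a (by simp)) b (hall b (by simp)) hab ?_
      rw [neg_eq_of_add_eq_zero_right hs]
      exact hall c (by simp)
    subst hab
    obtain rfl := F3.eq_of_add_add_eq_zero hs
    exact ⟨c, hall c (by simp), rfl⟩
  · right
    push Not at hall
    obtain ⟨g, hgB, hg⟩ := hall
    obtain ⟨B, rfl⟩ := Multiset.exists_cons_of_mem hgB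
    obtain ⟨U, hU, hUc, hUs⟩ : ∃ U ≤ X.val, U.card ≤ 2 ∧ g + U.sum = 0 := by
      by_cases hg0 : g = 0
      · exact ⟨0, by simp, by simp, by simp [hg0]⟩
      by_cases hgn : -g ∈ X
      · exact ⟨{-g}, by simpa using hgn, by simp, by simp⟩
      obtain ⟨x, hx, y, hy, hxy, h⟩ := hX.exists_add_add_eq_zero hq.card_eq hg hg0 hgn
      refine ⟨{x, y}, (Multiset.le_iff_subset (by simpa using hxy)).2 ?_, by simp,
        by simpa [add_assoc] using h⟩
      simp [Multiset.subset_iff, hx, hy]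
    obtain ⟨Y, hY⟩ := Multiset.le_iff_exists_add.1 hU
    have hXs : X.val.sum = 0 := by
      rw [← hq.sum_eq, Finset.sum_eq_multiset_sum, Multiset.map_id']
    have hXc : U.card + Y.card = 8 := by
      rw [← Multiset.card_add, ← hY, Finset.card_val, hq.card_eq]
    have hQs : (B + (X.val + Y)).sum = 0 := by
      have h1 : U.sum + Y.sum = 0 := by rw [← Multiset.sum_add, ← hY, hXs]
      rw [Multiset.sum_cons] at hB0
      rw [Multiset.sum_add, Multiset.sum_add, hXs, zero_add]
      have : B.sum + Y.sum = (g + B.sum) + (U.sum + Y.sum) - (g + U.sum) := by abel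
      rw [this, hB0, h1, hUs]
      simp
    have hBc : B.card = 2 := by simpa using hB
    by_cases hsf : IsShortFree 3 (B + (X.val + Y))
    · obtain ⟨X', -, hq', hX'⟩ := hsf.exists_eq_two_cap hQs (by
        rw [Multiset.card_add, Multiset.card_add, Finset.card_val, hq.card_eq]; omega)
      have hUc2 : U.card = 2 := by
        have := congrArg Multiset.card hX'
        simp only [Multiset.card_add, Finset.card_val, hq.card_eq, hq'.card_eq] at this
        omega
      obtain ⟨x, y, rfl⟩ := Multiset.card_eq_two.1 hUc2
      have hnd : ({x, y} : Multiset F3).Nodup := Multiset.nodup_of_le hU X.nodup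
      have hxy : x ≠ y := by simpa using hnd
      have hUB : {x, y} ≤ B := by
        refine (Multiset.le_iff_subset hnd).2 fun z hz => ?_
        have hz1 : Multiset.count z X.val = 1 :=
          Multiset.count_eq_one_of_mem X.nodup (Multiset.mem_of_le hU hz)
        have hz2 : Multiset.count z {x, y} = 1 := Multiset.count_eq_one_of_mem hnd hz
        have e1 := congrArg (Multiset.count z) hX'
        have e2 := congrArg (Multiset.count z) hY
        simp only [Multiset.count_add] at e1 e2
        refine Multiset.count_pos.1 ?_
        omega
      obtain rfl := Multiset.eq_of_le_of_card_le hUB (by omega)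
      refine ⟨{x, x, x}, {y, y, y}, ⟨by simp, by simp, ?_⟩, ⟨by simp, by simp, ?_⟩, ?_⟩
      · simpa [add_assoc] using F3.three_nsmul x
      · simpa [add_assoc] using F3.three_nsmul y
      · have : ({x, x, x} + {y, y, y} : Multiset F3) = {x, y} + ({x, y} + {x, y}) := by
          simp only [← Multiset.singleton_add, Multiset.insert_eq_cons]
          abel
        rw [this]
        exact add_le_add (Multiset.le_cons_self _ _) (add_le_add hU hU)
    · simp only [IsShortFree, not_forall, not_not] at hsf
      obtain ⟨C, hC, h0, h3, hs⟩ := hsf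
      refine ⟨g ::ₘ U, C, ⟨by simp, by simpa using Nat.lt_succ_of_le hUc, by simpa using hUs⟩,
        ⟨h0, h3, hs⟩, ?_⟩
      calc g ::ₘ U + C ≤ g ::ₘ U + (B + (X.val + Y)) := by gcongr
        _ = g ::ₘ B + (X.val + (U + Y)) := by simp only [← Multiset.singleton_add]; abel
        _ = g ::ₘ B + (X.val + X.val) := by rw [← hY]

end Three

section Main

variable {V : Type*} [AddCommGroup V]

/-- Disjoint blocks of length at most three with sums divisible by three cannot be more than
`7m - 7` in number within `S`, and if there are `7m - 7`, then their values are evenly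
distributed over the nonzero classes modulo two. -/
structure IsExtremal (φ : V →+ F2) (m : ℕ) (S : Multiset V) : Prop where
  card_add_le : ∀ P, IsPacking 3 3 P → (P.map Prod.fst).sum ≤ S → P.card + 7 ≤ 7 * m
  ne_zero : ∀ P, IsPacking 3 3 P → (P.map Prod.fst).sum ≤ S → P.card + 7 = 7 * m →
    ∀ b ∈ P, φ b.2 ≠ 0
  count_eq : ∀ P, IsPacking 3 3 P → (P.map Prod.fst).sum ≤ S → P.card + 7 = 7 * m →
    ∀ v ≠ 0, (P.map fun b => φ b.2).count v + 1 = m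

theorem isExtremal {φ : V →+ F2} (hφ : KerDvd 2 φ) {k : ℕ} {S : Multiset V}
    (h : ¬ HasShortDvdSum (3 * 2 ^ k) (3 * 2 ^ k) S) : IsExtremal φ (2 ^ k) S := by
  have key : ∀ P, IsPacking 3 3 P → (P.map Prod.fst).sum ≤ S →
      ¬ HasShortDvdSum (2 ^ k) (2 ^ k) (P.map Prod.snd) :=
    fun P hP hle hs => h ((hP.hasShortDvdSum hs).mono hle)
  refine ⟨fun P hP hle => ?_, fun P hP hle hc b hb => ?_, fun P hP hle hc v hv => ?_⟩
  · by_contra! hcon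
    exact key P hP hle (hasShortDvdSum_two_pow hφ k _ (by rw [Multiset.card_map]; omega))
  · exact (extremal_structure hφ k _ (by rwa [Multiset.card_map]) (key P hP hle)).1 b.2
      (Multiset.mem_map_of_mem _ hb)
  · have := (extremal_structure hφ k _ (by rwa [Multiset.card_map]) (key P hP hle)).2.2 v hv
    rwa [Multiset.map_map] at this

theorem IsExtremal.eq_of_cons {φ : V →+ F2} {m : ℕ} {S : Multiset V} (h : IsExtremal φ m S)
    {P : Multiset (Multiset V × V)} {b c : Multiset V × V} (hb : IsPacking 3 3 (b ::ₘ P))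
    (hc : IsPacking 3 3 (c ::ₘ P)) (hbS : ((b ::ₘ P).map Prod.fst).sum ≤ S)
    (hcS : ((c ::ₘ P).map Prod.fst).sum ≤ S) (hcard : P.card + 8 = 7 * m) : φ b.2 = φ c.2 := by
  by_contra hne
  have h0 := h.ne_zero _ hb hbS (by rw [Multiset.card_cons]; omega) b (by simp)
  have e1 := h.count_eq _ hb hbS (by rw [Multiset.card_cons]; omega) _ h0
  have e2 := h.count_eq _ hc hcS (by rw [Multiset.card_cons]; omega) _ h0
  rw [Multiset.map_cons, Multiset.count_cons_self] at e1
  rw [Multiset.map_cons, Multiset.count_cons_of_ne hne] at e2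
  omega

theorem F3.three_smul (x : F3) : 3 • x = 0 := by
  revert x; decide

theorem F2.three_smul (x : F2) : 3 • x = x := by
  revert x; decide

/-- Splitting an extremal sequence into `7m - 7` blocks and a remainder of length `16`. -/
theorem IsExtremal.exists_packing {φ : V →+ F2} {ψ : V →+ F3} (hψ : KerDvd 3 ψ) {m : ℕ}
    {S : Multiset V} (h : IsExtremal φ m S) (hS : ψ S.sum = 0) (hc : S.card + 7 = 21 * m) :
    ∃ P R X, IsPacking 3 3 P ∧ (P.map Prod.fst).sum + R = S ∧ P.card + 7 = 7 * m ∧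
      IsCap X ∧ IsQuadric X ∧ R.map ψ = X.val + X.val := by
  obtain ⟨P, R, hP, rfl, hR⟩ := exists_isPacking_add_eq hψ 3 S
  have h1 := h.card_add_le P hP (Multiset.le_add_right _ _)
  have h2 := hP.card_sum_le
  rw [Multiset.card_add] at hc
  rw [Multiset.sum_add, map_add, hP.sum_sum, map_nsmul, F3.three_smul, zero_add,
    map_multiset_sum_eq] at hS
  obtain ⟨X, hX, hq, hRX⟩ := hR.exists_eq_two_cap hS (by rw [Multiset.card_map]; omega)
  have h3 : R.card = 16 := by
    rw [← Multiset.card_map ψ, hRX, Multiset.card_add, Finset.card_val, hq.card_eq]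
  exact ⟨P, R, X, hP, rfl, by omega, hX, hq, hRX⟩

theorem IsExtremal.exists_block {φ : V →+ F2} {m : ℕ} (hm : 4 ≤ m) {P : Multiset (Multiset V × V)}
    {R : Multiset V} (h : IsExtremal φ m ((P.map Prod.fst).sum + R)) (hP : IsPacking 3 3 P)
    (hcard : P.card + 7 = 7 * m) (hc : ((P.map Prod.fst).sum + R).card + 7 = 21 * m)
    (hR : R.card = 16) {v : F2} (hv : v ≠ 0) : ∃ b ∈ P, b.1.card = 3 ∧ φ b.2 = v := by
  have e := h.count_eq P hP (Multiset.le_add_right _ _) hcard v hv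
  rw [Multiset.count_map] at e
  by_contra! hcon
  have hsplit := Multiset.filter_add_not (fun b : Multiset V × V => v = φ b.2) P
  have h2 : IsPacking 3 2 (P.filter fun b => v = φ b.2) := by
    intro b hb
    rw [Multiset.mem_filter] at hb
    obtain ⟨h0, h3, hs⟩ := hP b hb.1
    have : b.1.card ≠ 3 := fun h => hcon b hb.1 h hb.2.symm
    exact ⟨h0, by omega, hs⟩
  have h3 : IsPacking 3 3 (P.filter fun b => ¬ v = φ b.2) := hP.mono (Multiset.filter_le _ _)
  have c1 := congrArg Multiset.card hsplit
  rw [← hsplit, Multiset.map_add, Multiset.sum_add] at hc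
  have c2 := h2.card_sum_le
  have c3 := h3.card_sum_le
  simp only [Multiset.card_add] at c1 hc
  omega

/-- Every full block determines a point of the cap over which all remaining terms lie in the
class modulo two of the block. -/
theorem IsExtremal.exists_point {φ : V →+ F2} {ψ : V →+ F3} (hψ : KerDvd 3 ψ) {m : ℕ}
    {P : Multiset (Multiset V × V)} {R : Multiset V}
    (h : IsExtremal φ m ((P.map Prod.fst).sum + R)) (hP : IsPacking 3 3 P)
    (hcard : P.card + 7 = 7 * m) {X : Finset F3} (hX : IsCap X) (hq : IsQuadric X)
    (hR : R.map ψ = X.val + X.val) {b : Multiset V × V} (hb : b ∈ P) (hb3 : b.1.card = 3) :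
    ∃ x ∈ X, ∀ s ∈ R, ψ s = x → φ s = φ b.2 := by
  obtain ⟨P, rfl⟩ := Multiset.exists_cons_of_mem hb
  rw [Multiset.card_cons] at hcard
  have hP' := hP.mono (Multiset.le_cons_self P b)
  obtain ⟨-, -, hbs⟩ := hP b hb
  have hb0 : (b.1.map ψ).sum = 0 := by
    rw [← map_multiset_sum_eq, hbs, map_nsmul, F3.three_smul]
  rcases hX.exchange hq (by rwa [Multiset.card_map]) hb0 with ⟨x, hx, hbx⟩ |
    ⟨C₁, C₂, ⟨h10, h13, h1s⟩, ⟨h20, h23, h2s⟩, hle⟩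
  · refine ⟨x, hx, fun s hs hsx => ?_⟩
    have hψb : ∀ p ∈ b.1, ψ p = x := by
      intro p hp
      have := Multiset.mem_map_of_mem ψ hp
      rw [hbx] at this
      simpa using this
    have hswap : ∀ p ∈ b.1, φ p = φ s := by
      intro p hp
      obtain ⟨B, hB⟩ := Multiset.exists_cons_of_mem hp
      have hBs : ψ (s ::ₘ B).sum = 0 := by
        rw [hB, Multiset.map_cons, Multiset.sum_cons, ← map_multiset_sum_eq, hψb p hp] at hb0
        rw [Multiset.sum_cons, map_add, hsx, hb0]
      obtain ⟨w, hw⟩ := hψ _ hBs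
      have hBc : B.card = 2 := by simpa [hB] using hb3
      have hc : IsPacking 3 3 ((s ::ₘ B, w) ::ₘ P) := hP'.cons (by simp) (by simp [hBc]) hw
      have heq := h.eq_of_cons hP hc (Multiset.le_add_right _ _) ?_ (by omega)
      · have e1 := congrArg φ hbs
        have e2 := congrArg φ hw
        rw [map_nsmul, F2.three_smul] at e1 e2
        rw [← e1, ← e2, hB, Multiset.sum_cons, Multiset.sum_cons, map_add, map_add] at heq
        exact add_right_cancel heq
      · obtain ⟨R', rfl⟩ := Multiset.exists_cons_of_mem hs
        rw [Multiset.map_cons, Multiset.sum_cons, Multiset.map_cons, Multiset.sum_cons, hB]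
        rw [Multiset.le_iff_exists_add]
        refine ⟨p ::ₘ R', ?_⟩
        simp only [← Multiset.singleton_add]
        abel
    have e := congrArg φ hbs
    rw [map_nsmul, F2.three_smul, map_multiset_sum_eq, Multiset.map_congr rfl hswap,
      Multiset.map_const', hb3, Multiset.sum_replicate, F2.three_smul] at e
    exact e
  · exfalso
    rw [← hR, ← Multiset.map_add] at hle
    obtain ⟨D, hD, hDC⟩ := Multiset.exists_le_map_eq hle
    obtain ⟨D₁, hD₁, rfl⟩ := Multiset.exists_le_map_eq (hDC ▸ Multiset.le_add_right _ _ : C₁ ≤ _)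
    obtain ⟨D₂, rfl⟩ := Multiset.le_iff_exists_add.1 hD₁
    rw [Multiset.map_add] at hDC
    obtain rfl := add_left_cancel hDC
    obtain ⟨w₁, hw₁⟩ := hψ D₁.sum (by rw [map_multiset_sum_eq, h1s])
    obtain ⟨w₂, hw₂⟩ := hψ D₂.sum (by rw [map_multiset_sum_eq, h2s])
    rw [Multiset.card_map] at h13 h23
    have hQ := (hP'.cons (B := D₁) (by rintro rfl; exact h10 rfl) h13 hw₁).cons (B := D₂)
      (by rintro rfl; exact h20 rfl) h23 hw₂
    have := h.card_add_le _ hQ (by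
      simp only [Multiset.map_cons, Multiset.sum_cons]
      calc D₂ + (D₁ + (P.map Prod.fst).sum) = (D₁ + D₂) + (P.map Prod.fst).sum := by abel
        _ ≤ (b.1 + R) + (P.map Prod.fst).sum := by gcongr
        _ = b.1 + (P.map Prod.fst).sum + R := by abel)
    simp only [Multiset.card_cons] at this
    omega

/-- If the class modulo two is constant over all but one point of the cap, then some sequence of
length at most six has sum zero modulo two and three. -/
theorem exists_short_sum_zero {φ : V →+ F2} {ψ : V →+ F3} {R : Multiset V} {X : Finset F3}
    (hq : IsQuadric X) (hR : R.map ψ = X.val + X.val) {f : F2 → F3}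
    (hf : ∀ v ≠ 0, f v ∈ X) (hfR : ∀ v ≠ 0, ∀ s ∈ R, ψ s = f v → φ s = v) :
    ∃ B ≤ R, B ≠ 0 ∧ B.card ≤ 6 ∧ φ B.sum = 0 ∧ ψ B.sum = 0 := by
  have hsurj : ∀ x ∈ X, ∃ s ∈ R, ψ s = x := by
    intro x hx
    rw [← Multiset.mem_map, hR]
    simpa using hx
  have hinj : Set.InjOn f F2.nonzero := by
    intro v hv w hw hvw
    rw [Finset.mem_coe, F2.mem_nonzero] at hv hw
    obtain ⟨s, hs, hsx⟩ := hsurj _ (hf v hv)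
    rw [← hfR v hv s hs hsx, ← hfR w hw s hs (hsx.trans hvw)]
  have himg : (F2.nonzero.image f).card = 7 := by
    rw [Finset.card_image_of_injOn hinj, F2.card_nonzero]
  have hsub : F2.nonzero.image f ⊆ X := by
    intro x hx
    obtain ⟨v, hv, rfl⟩ := Finset.mem_image.1 hx
    exact hf v (F2.mem_nonzero.1 hv)
  obtain ⟨p, hp⟩ := Finset.card_eq_one.1 (show (X \ F2.nonzero.image f).card = 1 by
    rw [Finset.card_sdiff_of_subset hsub, himg, hq.card_eq])
  have hpX : p ∈ X ∧ p ∉ F2.nonzero.image f := by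
    rw [← Finset.mem_sdiff, hp]; simp
  have hconst : ∀ s ∈ R, ∀ t ∈ R, ψ s ≠ p → ψ s = ψ t → φ s = φ t := by
    intro s hs t ht hsp hst
    have hsX : ψ s ∈ X := by
      have := Multiset.mem_map_of_mem ψ hs
      rw [hR] at this
      simpa using this
    have : ψ s ∈ F2.nonzero.image f := by
      by_contra hcon
      have : ψ s ∈ X \ F2.nonzero.image f := Finset.mem_sdiff.2 ⟨hsX, hcon⟩
      rw [hp, Finset.mem_singleton] at this
      exact hsp this
    obtain ⟨v, hv, hvs⟩ := Finset.mem_image.1 this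
    rw [F2.mem_nonzero] at hv
    rw [hfR v hv s hs hvs.symm, hfR v hv t ht (by rw [hvs, hst])]
  obtain ⟨g, hg⟩ : ∃ g : F3 → F2, ∀ s ∈ R, ψ s ≠ p → φ s = g (ψ s) := by
    choose! r hr using hsurj
    refine ⟨fun x => φ (r x), fun s hs hsp => ?_⟩
    have hsX : ψ s ∈ X := by
      have := Multiset.mem_map_of_mem ψ hs
      rw [hR] at this
      simpa using this
    exact hconst s hs _ (hr _ hsX).1 hsp (hr _ hsX).2.symm
  obtain ⟨s, hs, hsp⟩ := hsurj p hpX.1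
  obtain ⟨R', rfl⟩ := Multiset.exists_cons_of_mem hs
  have key : ∀ C : Multiset F3, p ::ₘ C ≤ X.val + X.val → p ∉ C → C.card ≤ 5 →
      p + C.sum = 0 → φ s + (C.map g).sum = 0 →
      ∃ B ≤ s ::ₘ R', B ≠ 0 ∧ B.card ≤ 6 ∧ φ B.sum = 0 ∧ ψ B.sum = 0 := by
    intro C hC hpC h5 h3 h2
    rw [← hR, Multiset.map_cons, hsp, Multiset.cons_le_cons_iff] at hC
    obtain ⟨D, hD, rfl⟩ := Multiset.exists_le_map_eq hC
    refine ⟨s ::ₘ D, Multiset.cons_le_cons _ hD, by simp, by simpa using Nat.lt_succ_of_le h5,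
      ?_, ?_⟩
    · rw [Multiset.sum_cons, map_add, map_multiset_sum_eq, ← h2, Multiset.map_map]
      refine congrArg (fun u => φ s + Multiset.sum u) (Multiset.map_congr rfl fun t ht => ?_)
      exact hg t (Multiset.mem_cons_of_mem (Multiset.mem_of_le hD ht)) fun h =>
        hpC (h ▸ Multiset.mem_map_of_mem ψ ht)
    · rw [Multiset.sum_cons, map_add, map_multiset_sum_eq, hsp, h3]
  have hle : ∀ C : Multiset F3, C.Nodup → (∀ x ∈ C, x ∈ X) → C ≤ X.val :=
    fun C hC h => (Multiset.le_iff_subset hC).2 h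
  by_cases hy : φ s = 0
  · obtain ⟨a, ha, b, hb, hab, hap, hbp, hpab⟩ := hq.eq_add p hpX.1
    refine key ({a, b} + {a, b}) ?_ ?_ (by simp) ?_ ?_
    · rw [← Multiset.cons_add]
      refine add_le_add (hle _ ?_ ?_) (hle _ ?_ ?_)
      · simp [hab, hap.symm, hbp.symm]
      · simp [hpX.1, ha, hb]
      · simp [hab]
      · simp [ha, hb]
    · simp [hap.symm, hbp.symm]
    · simp only [Multiset.sum_add, Multiset.insert_eq_cons, Multiset.sum_cons,
        Multiset.sum_singleton, ← hpab]
      rw [← add_assoc, F3.three_nsmul]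
    · rw [hy, zero_add, Multiset.map_add, Multiset.sum_add, F2.add_self]
  · have hqX := hf _ hy
    have hqp : p ≠ f (φ s) := fun h =>
      hpX.2 (h ▸ Finset.mem_image_of_mem f (F2.mem_nonzero.2 hy))
    have hgq : g (f (φ s)) = φ s := by
      obtain ⟨t, ht, htq⟩ : ∃ t ∈ s ::ₘ R', ψ t = f (φ s) := hsurj _ hqX
      rw [← htq, ← hg t ht (htq ▸ hqp.symm)]
      exact hfR _ hy t ht htq
    obtain ⟨a, ha, b, hb, ⟨hap, haq, hbp, hbq⟩, h⟩ := hq.add_eq p hpX.1 _ hqX hqp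
    rcases h with h | ⟨hab, h⟩
    · refine key ({f (φ s), a} + {a}) ?_ ?_ (by simp) ?_ ?_
      · have : p ::ₘ ({f (φ s), a} + {a}) = {p, a} + {f (φ s), a} := by
          simp only [← Multiset.singleton_add, Multiset.insert_eq_cons]; abel
        rw [this]
        refine add_le_add (hle _ ?_ ?_) (hle _ ?_ ?_)
        · simp [hap.symm]
        · simp [hpX.1, ha]
        · simp [haq.symm]
        · simp [hqX, ha]
      · simp [hqp, hap.symm]
      · simp only [Multiset.sum_add, Multiset.insert_eq_cons, Multiset.sum_cons,
          Multiset.sum_singleton]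
        rw [← F3.three_nsmul a]
        nth_rewrite 4 [h]
        abel
      · simp only [Multiset.map_add, Multiset.sum_add, Multiset.insert_eq_cons, Multiset.map_cons,
          Multiset.sum_cons, Multiset.map_singleton, Multiset.sum_singleton, hgq]
        rw [add_assoc, F2.add_self, add_zero, F2.add_self]
    · refine key ({f (φ s), a, b} + {a, b}) ?_ ?_ (by simp) ?_ ?_
      · have : p ::ₘ ({f (φ s), a, b} + {a, b}) = {p, a, b} + {f (φ s), a, b} := by
          simp only [← Multiset.singleton_add, Multiset.insert_eq_cons]; abel
        rw [this]
        refine add_le_add (hle _ ?_ ?_) (hle _ ?_ ?_)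
        · simp [hap.symm, hbp.symm, hab]
        · simp [hpX.1, ha, hb]
        · simp [haq.symm, hbq.symm, hab]
        · simp [hqX, ha, hb]
      · simp [hqp, hap.symm, hbp.symm]
      · simp only [Multiset.sum_add, Multiset.insert_eq_cons, Multiset.sum_cons,
          Multiset.sum_singleton, h]
        rw [← F3.three_nsmul (p + f (φ s))]
        abel
      · simp only [Multiset.map_add, Multiset.sum_add, Multiset.insert_eq_cons, Multiset.map_cons,
          Multiset.sum_cons, Multiset.map_singleton, Multiset.sum_singleton, hgq]
        rw [add_assoc, F2.add_self, add_zero, F2.add_self]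

theorem hasShortDvdSum_of_card_eq {φ : V →+ F2} {ψ : V →+ F3} (hφ : KerDvd 2 φ)
    (hψ : KerDvd 3 ψ) {k : ℕ} (hk : 1 ≤ k) {S : Multiset V} (hS : ψ S.sum = 0)
    (hc : S.card + 7 = 21 * 2 ^ (k + 1)) :
    HasShortDvdSum (3 * 2 ^ (k + 1)) (3 * 2 ^ (k + 1)) S := by
  by_contra hno
  have hm : 4 ≤ 2 ^ (k + 1) := Nat.pow_le_pow_right (n := 2) (by norm_num) (by omega : 2 ≤ k + 1)
  have h := isExtremal hφ hno
  obtain ⟨P, R, X, hP, rfl, hcard, hX, hq, hR⟩ := h.exists_packing hψ hS hc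
  have hR16 : R.card = 16 := by
    rw [← Multiset.card_map ψ, hR, Multiset.card_add, Finset.card_val, hq.card_eq]
  have hf : ∀ v : F2, v ≠ 0 → ∃ x ∈ X, ∀ s ∈ R, ψ s = x → φ s = v := by
    intro v hv
    obtain ⟨b, hb, hb3, rfl⟩ := h.exists_block hm hP hcard hc hR16 hv
    exact h.exists_point hψ hP hcard hX hq hR hb hb3
  choose! f hfX hfR using hf
  obtain ⟨B, hB, hB0, hB6, h2, h3⟩ := exists_short_sum_zero hq hR hfX hfR
  obtain ⟨u, hu⟩ := hφ _ h2
  obtain ⟨v, hv⟩ := hψ _ h3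
  have hw : B.sum = 6 • (u - v) := by
    calc B.sum = 3 • B.sum - 2 • B.sum := by abel
      _ = 3 • (2 • u) - 2 • (3 • v) := by rw [← hu, ← hv]
      _ = 6 • (u - v) := by rw [← mul_nsmul', ← mul_nsmul', nsmul_sub]
  obtain ⟨Q, hQ, hQle, hQc⟩ := exists_pairs_card_le hφ (P.map Prod.snd)
  obtain ⟨Q', hQ', hsnd, hQ'le⟩ := hP.comp hQ hQle
  have hcQ : Q'.card = Q.card := by rw [← Multiset.card_map Prod.snd, hsnd, Multiset.card_map]
  rw [Multiset.card_map] at hQc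
  have hfin := hasShortDvdSum_of_packing hφ (k := k) (hQ'.cons hB0 hB6 hw) (by
    rw [Multiset.card_cons]
    rw [pow_succ] at hcard
    omega) (S := (P.map Prod.fst).sum + R) (by
      rw [Multiset.map_cons, Multiset.sum_cons, add_comm]
      exact add_le_add hQ'le hB)
  refine hno ?_
  rwa [pow_succ', ← mul_assoc]

end Main

section Final

/-- Coordinatewise reduction modulo a divisor. -/
def reduction (n d : ℕ) (h : d ∣ n) : (Fin 3 → ZMod n) →+ (Fin 3 → ZMod d) :=
  (ZMod.castHom h (ZMod d)).toAddMonoidHom.compLeft (Fin 3)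

theorem kerDvd_reduction {n d : ℕ} [NeZero n] (h : d ∣ n) : KerDvd d (reduction n d h) := by
  intro v hv
  have : ∀ i, ∃ w : ZMod n, v i = d • w := by
    intro i
    have hi : ZMod.castHom h (ZMod d) (v i) = 0 := congrFun hv i
    rw [ZMod.castHom_apply, ZMod.cast_eq_val, ZMod.natCast_eq_zero_iff] at hi
    obtain ⟨c, hc⟩ := hi
    exact ⟨(c : ZMod n), by rw [nsmul_eq_mul, ← Nat.cast_mul, ← hc, ZMod.natCast_zmod_val]⟩
  choose w hw using this
  exact ⟨w, funext hw⟩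

theorem exponent_fin_three_zmod (n : ℕ) : AddMonoid.exponent (Fin 3 → ZMod n) = n := by
  refine Nat.dvd_antisymm (AddMonoid.exponent_dvd_of_forall_nsmul_eq_zero fun g => ?_) ?_
  · ext i; simp
  · have := AddMonoid.exponent_nsmul_eq_zero (Pi.single 0 1 : Fin 3 → ZMod n)
    have h0 := congrFun this 0
    rw [Pi.smul_apply, Pi.single_eq_same, nsmul_one] at h0
    exact (ZMod.natCast_eq_zero_iff _ _).1 h0

theorem HasShortDvdSum.hasShortZeroSumSubseq {n : ℕ} {S : Multiset (Fin 3 → ZMod n)}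
    (h : HasShortDvdSum n n S) : HasShortZeroSumSubseq S := by
  obtain ⟨T, hT, h0, hn, w, hw⟩ := h
  refine ⟨T, hT, ?_, Multiset.card_pos.2 h0, by rwa [exponent_fin_three_zmod]⟩
  rw [hw]
  ext i; simp

theorem IsShortFree.card_le {R : Multiset F3} (h : IsShortFree 3 R) : R.card ≤ 54 := by
  rw [← Multiset.sum_count_eq_card (s := Finset.univ) fun a _ => Finset.mem_univ a]
  refine (Finset.sum_le_card_nsmul _ _ 2 fun x _ => ?_).trans (by simp)
  by_contra! hcon
  refine h (Multiset.replicate 3 x) (Multiset.le_count_iff_replicate_le.1 hcon) (by simp)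
    (by simp) ?_
  rw [Multiset.sum_replicate, F3.three_smul]

variable {V : Type*} [AddCommGroup V]

theorem hasShortDvdSum_of_le_card {φ : V →+ F2} {ψ : V →+ F3} (hφ : KerDvd 2 φ)
    (hψ : KerDvd 3 ψ) {k : ℕ} {S : Multiset V} (hc : 21 * 2 ^ k + 54 ≤ S.card) :
    HasShortDvdSum (3 * 2 ^ k) (3 * 2 ^ k) S := by
  obtain ⟨P, R, hP, rfl, hR⟩ := exists_isPacking_add_eq hψ 3 S
  have h1 := hR.card_le
  have h2 := hP.card_sum_le
  rw [Multiset.card_map] at h1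
  rw [Multiset.card_add] at hc
  exact hasShortDvdSum_of_packing hφ hP (by omega) (Multiset.le_add_right _ _)

/-- The sequence in which each nonzero vector with entries in `{0, 1}` occurs `n - 1` times has
no short zero-sum subsequence. -/
theorem exists_no_short (n : ℕ) (hn : 2 ≤ n) : ∃ S : Multiset (Fin 3 → ZMod n),
    S.card = 7 * (n - 1) ∧ ¬ HasShortZeroSumSubseq S := by
  let A : Finset (Fin 3 → Fin 2) := Finset.univ.erase 0
  have hA : A.card = 7 := by simp [A]
  let e : (Fin 3 → Fin 2) → (Fin 3 → ZMod n) := fun u i => ((u i : ℕ) : ZMod n)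
  let S0 : Multiset (Fin 3 → Fin 2) := (n - 1) • A.val
  refine ⟨S0.map e, ?_, ?_⟩
  · simp only [S0, Multiset.card_map, Multiset.card_nsmul, Finset.card_val, hA]
    ring
  rintro ⟨T', hT', hs, h1, hn'⟩
  rw [exponent_fin_three_zmod] at hn'
  obtain ⟨T, hT, rfl⟩ := Multiset.exists_le_map_eq hT'
  rw [Multiset.card_map] at h1 hn'
  have hle : ∀ i, (T.map fun u => (u i : ℕ)).sum ≤ T.card := by
    intro i
    have := Multiset.sum_le_card_nsmul (T.map fun u => (u i : ℕ)) 1 (by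
      intro x hx
      obtain ⟨u, -, rfl⟩ := Multiset.mem_map.1 hx
      omega)
    simpa using this
  have hdvd : ∀ i, n ∣ (T.map fun u => (u i : ℕ)).sum := by
    intro i
    rw [← ZMod.natCast_eq_zero_iff]
    have := congrArg (Pi.evalAddMonoidHom (fun _ : Fin 3 => ZMod n) i) hs
    rw [map_multiset_sum, Multiset.map_map, map_zero] at this
    rw [Nat.cast_multiset_sum, Multiset.map_map]
    exact this
  have hdich : ∀ i, (∀ u ∈ T, u i = 0) ∨ (∀ u ∈ T, u i = 1) ∧ T.card = n := by
    intro i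
    rcases Nat.eq_zero_or_pos (T.map fun u => (u i : ℕ)).sum with h0 | hpos
    · left
      intro u hu
      have := Multiset.sum_eq_zero_iff.1 h0 _ (Multiset.mem_map_of_mem (fun u => (u i : ℕ)) hu)
      exact Fin.ext this
    · right
      have h2 := Nat.le_of_dvd hpos (hdvd i)
      have h3 := hle i
      refine ⟨fun u hu => ?_, by omega⟩
      by_contra hne
      have hu0 : (u i : ℕ) = 0 := by omega
      obtain ⟨T1, rfl⟩ := Multiset.exists_cons_of_mem hu
      have := Multiset.sum_le_card_nsmul (T1.map fun u => (u i : ℕ)) 1 (by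
        intro x hx
        obtain ⟨u, -, rfl⟩ := Multiset.mem_map.1 hx
        omega)
      simp only [Multiset.map_cons, Multiset.sum_cons, Multiset.card_cons, Multiset.card_map,
        smul_eq_mul, mul_one] at *
      omega
  obtain ⟨u, hu⟩ := Multiset.card_pos_iff_exists_mem.1 h1
  have hall : ∀ w ∈ T, w = u := by
    intro w hw
    ext i
    rcases hdich i with h | h
    · rw [h w hw, h u hu]
    · rw [h.1 w hw, h.1 u hu]
  have huA : u ∈ A := by
    have := Multiset.mem_of_le hT hu
    exact (Multiset.mem_nsmul.1 this).2
  have hcard : T.card = n := by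
    by_contra hne
    refine (Finset.mem_erase.1 huA).1 (funext fun i => ?_)
    exact ((hdich i).resolve_right fun h => hne h.2) u hu
  have hrep := Multiset.eq_replicate.2 ⟨hcard, hall⟩
  have := Multiset.le_count_iff_replicate_le.2 (hrep ▸ hT)
  rw [Multiset.count_nsmul, Multiset.count_eq_one_of_mem A.nodup huA] at this
  omega

/-- If all zero-sum sequences of length `t` have a short zero-sum subsequence, then sequences of
length `t - 1` have a zero-sum subsequence. -/
theorem davenport_add_one_le {G : Type*} [AddCommGroup G] {t : ℕ} (ht : AddMonoid.exponent G < t)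
    (h : ∀ S : Multiset G, S.card = t → S.sum = 0 → HasShortZeroSumSubseq S) :
    davenport G + 1 ≤ t := by
  have : davenport G ≤ t - 1 := by
    refine Nat.sInf_le fun S hS => ?_
    obtain ⟨U, hU, hUc⟩ := Multiset.exists_le_card_eq hS
    obtain ⟨T, hT, hs, h1, hn⟩ := h (-U.sum ::ₘ U) (by rw [Multiset.card_cons]; omega) (by simp)
    have hT0 : T ≠ 0 := Multiset.card_pos.1 h1
    obtain ⟨W, hW⟩ := Multiset.le_iff_exists_add.1 hT
    have hWs : W.sum = 0 := by
      have := congrArg Multiset.sum hW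
      rw [Multiset.sum_cons, neg_add_cancel, Multiset.sum_add, hs, zero_add] at this
      exact this.symm
    have hW0 : W ≠ 0 := by
      rintro rfl
      have := congrArg Multiset.card hW
      simp only [Multiset.card_cons, Multiset.card_add, Multiset.card_zero] at this
      omega
    have hmem : -U.sum ∈ T + W := by rw [← hW]; exact Multiset.mem_cons_self _ _
    rcases Multiset.mem_add.1 hmem with hmem | hmem
    · obtain ⟨T', rfl⟩ := Multiset.exists_cons_of_mem hmem
      rw [Multiset.cons_add, Multiset.cons_inj_right] at hW
      exact ⟨W, (hW ▸ Multiset.le_add_left _ _).trans hU, hW0, hWs⟩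
    · obtain ⟨W', rfl⟩ := Multiset.exists_cons_of_mem hmem
      rw [Multiset.add_cons, Multiset.cons_inj_right] at hW
      exact ⟨T, (hW ▸ Multiset.le_add_right _ _).trans hU, hT0, hs⟩
  omega

theorem lt_etaConst {G : Type*} [AddCommGroup G] {S : Multiset G} (hS : ¬ HasShortZeroSumSubseq S)
    (hex : ∃ d, ∀ T : Multiset G, d ≤ T.card → HasShortZeroSumSubseq T) :
    S.card < etaConst G := by
  by_contra! hcon
  exact hS (Nat.sInf_mem (s := {d : ℕ | ∀ S : Multiset G, d ≤ S.card → HasShortZeroSumSubseq S})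
    hex S hcon)

end Final

theorem stmt_2 (a : ℕ) (ha : 4 ≤ a) :
    (C0 (Fin 3 → ZMod (3 * 2 ^ a))).Nonempty := by
  obtain ⟨k, rfl⟩ : ∃ k, a = k + 1 := ⟨a - 1, by omega⟩
  have hpos : 0 < 2 ^ (k + 1) := by positivity
  have : NeZero (3 * 2 ^ (k + 1)) := ⟨by positivity⟩
  have hφ := kerDvd_reduction (n := 3 * 2 ^ (k + 1)) (d := 2) (Dvd.intro (3 * 2 ^ k) (by ring))
  have hψ := kerDvd_reduction (n := 3 * 2 ^ (k + 1)) (d := 3) (dvd_mul_right _ _)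
  have hC : ∀ S : Multiset (Fin 3 → ZMod (3 * 2 ^ (k + 1))), S.card = 21 * 2 ^ (k + 1) - 7 →
      S.sum = 0 → HasShortZeroSumSubseq S := fun S hc hs =>
    (hasShortDvdSum_of_card_eq hφ hψ (by omega) (by rw [hs, map_zero])
      (by omega)).hasShortZeroSumSubseq
  refine ⟨21 * 2 ^ (k + 1) - 7, davenport_add_one_le ?_ hC, ?_, hC⟩
  · rw [exponent_fin_three_zmod]
    omega
  · obtain ⟨S, hSc, hS⟩ := exists_no_short (3 * 2 ^ (k + 1)) (by omega)
    have := lt_etaConst hS ⟨21 * 2 ^ (k + 1) + 54, fun T hT =>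
      (hasShortDvdSum_of_le_card hφ hψ hT).hasShortZeroSumSubseq⟩
    omega
end

section
/- Let a, r be positive integers with either 3 ≤ r ≤ a, or a = 1 and r ≥ 3, and let G = C_{2^a}^r (the direct sum of r copies of the cyclic group of order 2^a). Then C_0(G) is nonempty. -/
namespace Multiset

theorem exists_le_map_eq_of_le_map {α β : Type*} {f : α → β} {T : Multiset β} {S : Multiset α}
    (h : T ≤ S.map f) : ∃ U ≤ S, U.map f = T := by
  induction T using Multiset.induction_on generalizing S with
  | empty => exact ⟨0, Multiset.zero_le _, rfl⟩
  | cons b T ih =>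
    obtain ⟨x, hx, rfl⟩ := mem_map.1 (mem_of_le h (mem_cons_self b T))
    obtain ⟨S, rfl⟩ := exists_cons_of_mem hx
    rw [map_cons, cons_le_cons_iff] at h
    obtain ⟨U, hU, rfl⟩ := ih h
    exact ⟨x ::ₘ U, (cons_le_cons_iff x).2 hU, map_cons f x U⟩

theorem exists_le_card_eq_of_le_card {α : Type*} {S : Multiset α} {n : ℕ} (h : n ≤ card S) :
    ∃ T ≤ S, card T = n := by
  have : 0 < card (powersetCard n S) := by
    rw [card_powersetCard]
    exact Nat.choose_pos h
  obtain ⟨T, hT⟩ := card_pos_iff_exists_mem.1 this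
  exact ⟨T, mem_powersetCard.1 hT⟩

theorem pair_le_of_mem_of_ne {α : Type*} {S : Multiset α} {x y : α} (hx : x ∈ S) (hy : y ∈ S)
    (hxy : x ≠ y) : {x, y} ≤ S := by
  rw [le_iff_subset (by simpa using hxy)]
  intro z hz
  simp only [insert_eq_cons, mem_cons, mem_singleton] at hz
  rcases hz with rfl | rfl <;> assumption

theorem join_singleton {α : Type*} (S : Multiset α) : join {S} = S :=
  sum_singleton S

end Multiset

namespace ShortZeroSum

open Multiset

variable {ι : Type*}

/-- Coordinatewise reduction of an integer vector modulo `n`. -/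
def red (n : ℕ) : (ι → ℤ) →+ (ι → ZMod n) := (Int.castAddHom (ZMod n)).compLeft ι

@[simp] theorem red_apply (n : ℕ) (x : ι → ℤ) (i : ι) : red n x i = (x i : ZMod n) := rfl

theorem red_eq_zero_iff {n : ℕ} {x : ι → ℤ} : red n x = 0 ↔ ∀ i, (n : ℤ) ∣ x i := by
  simp [funext_iff, ZMod.intCast_zmod_eq_zero_iff_dvd]

theorem red_two_nsmul_eq_zero_iff {a : ℕ} {x : ι → ℤ} :
    red (2 ^ (a + 1)) (2 • x) = 0 ↔ red (2 ^ a) x = 0 := by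
  simp only [red_eq_zero_iff]
  refine forall_congr' fun i => ?_
  simp only [Pi.smul_apply, nsmul_eq_mul, Nat.cast_pow, Nat.cast_ofNat, pow_succ']
  push_cast
  exact mul_dvd_mul_iff_left two_ne_zero

theorem nsmul_red (n : ℕ) (x : ι → ZMod n) : n • x = 0 := by
  ext i
  simp

/-- Coordinatewise half of an integer vector. -/
def half (x : ι → ℤ) : ι → ℤ := fun i => x i / 2

theorem two_nsmul_half {x : ι → ℤ} (h : red 2 x = 0) : 2 • half x = x := by
  ext i
  have := red_eq_zero_iff.1 h i
  simp only [half, Pi.smul_apply, nsmul_eq_mul]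
  exact Int.mul_ediv_cancel' this

/-- No nonempty subsequence of length at most `2 ^ a` has a sum divisible by `2 ^ a`. -/
def ShortFree (a : ℕ) (S : Multiset (ι → ℤ)) : Prop :=
  ∀ T ≤ S, T ≠ 0 → card T ≤ 2 ^ a → red (2 ^ a) T.sum ≠ 0

/-- A sequence of one or two integer vectors whose sum is even. -/
structure IsBlock (B : Multiset (ι → ℤ)) : Prop where
  ne_zero : B ≠ 0
  card_le : card B ≤ 2
  red_sum : red 2 B.sum = 0

theorem red_two_add_eq_zero {x y : ι → ℤ} (h : red 2 x = red 2 y) : red 2 (x + y) = 0 := by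
  rw [_root_.map_add, h, ← two_nsmul, nsmul_red]

theorem isBlock_pair {x y : ι → ℤ} (h : red 2 x = red 2 y) : IsBlock {x, y} where
  ne_zero := by simp
  card_le := by simp
  red_sum := by
    rw [insert_eq_cons, sum_cons, sum_singleton]
    exact red_two_add_eq_zero h

theorem isBlock_singleton {x : ι → ℤ} (h : red 2 x = 0) : IsBlock {x} where
  ne_zero := by simp
  card_le := by simp
  red_sum := by simpa using h

theorem card_join_le {P : Multiset (Multiset (ι → ℤ))} (hP : ∀ B ∈ P, IsBlock B) :
    card P.join ≤ 2 * card P := by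
  induction P using Multiset.induction_on with
  | empty => simp
  | cons B P ih =>
    have h₁ := (hP B (mem_cons_self B P)).card_le
    have h₂ := ih fun C hC => hP C (mem_cons_of_mem hC)
    rw [join_cons, card_add, card_cons]
    omega

theorem two_nsmul_sum_half {P : Multiset (Multiset (ι → ℤ))} (hP : ∀ B ∈ P, IsBlock B) :
    2 • (P.map fun B => half B.sum).sum = P.join.sum := by
  induction P using Multiset.induction_on with
  | empty => simp
  | cons B P ih =>
    rw [map_cons, sum_cons, join_cons, sum_add, smul_add,
      ih fun C hC => hP C (mem_cons_of_mem hC),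
      two_nsmul_half (hP B (mem_cons_self B P)).red_sum]

theorem join_ne_zero {P : Multiset (Multiset (ι → ℤ))} (hP : ∀ B ∈ P, IsBlock B) (h : P ≠ 0) :
    P.join ≠ 0 := by
  obtain ⟨B, hB⟩ := exists_mem_of_ne_zero h
  obtain ⟨x, hx⟩ := exists_mem_of_ne_zero (hP B hB).ne_zero
  intro h₀
  have := mem_join.2 ⟨B, hB, hx⟩
  simp [h₀] at this

theorem join_le_join {P Q : Multiset (Multiset (ι → ℤ))} (h : P ≤ Q) : P.join ≤ Q.join := by
  obtain ⟨P', rfl⟩ := Multiset.le_iff_exists_add.1 h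
  rw [join_add]
  exact Multiset.le_add_right _ _

theorem ShortFree.halves {a : ℕ} {S : Multiset (ι → ℤ)} (hS : ShortFree (a + 1) S)
    {P : Multiset (Multiset (ι → ℤ))} (hP : ∀ B ∈ P, IsBlock B) (hle : P.join ≤ S) :
    ShortFree a (P.map fun B => half B.sum) := by
  intro T hT hT₀ hTc h
  obtain ⟨U, hU, rfl⟩ := exists_le_map_eq_of_le_map hT
  have hUb : ∀ B ∈ U, IsBlock B := fun B hB => hP B (mem_of_le hU hB)
  refine hS U.join ((join_le_join hU).trans hle) (join_ne_zero hUb ?_) ?_ ?_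
  · rintro rfl
    exact hT₀ rfl
  · rw [card_map] at hTc
    have := card_join_le hUb
    rw [pow_succ]
    omega
  · rw [← two_nsmul_sum_half hUb]
    exact red_two_nsmul_eq_zero_iff.2 h

theorem exists_blocks (S : Multiset (ι → ℤ)) :
    ∃ (P : Multiset (Multiset (ι → ℤ))) (R : Multiset (ι → ℤ)), (∀ B ∈ P, IsBlock B) ∧
      P.join + R = S ∧ (R.map (red 2)).Nodup ∧ 0 ∉ R.map (red 2) := by
  induction hn : card S using Nat.strong_induction_on generalizing S with
  | _ n ih =>
    by_cases h : ∃ B ≤ S, IsBlock B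
    · obtain ⟨B, hB, hb⟩ := h
      obtain ⟨S', rfl⟩ := Multiset.le_iff_exists_add.1 hB
      have hlt : card S' < n := by
        have := card_pos.2 hb.ne_zero
        rw [← hn, card_add]
        omega
      obtain ⟨P, R, hP, rfl, hR⟩ := ih _ hlt S' rfl
      refine ⟨B ::ₘ P, R, ?_, by rw [join_cons, add_assoc], hR⟩
      intro C hC
      rcases mem_cons.1 hC with rfl | hC
      exacts [hb, hP C hC]
    · push Not at h
      refine ⟨0, S, by simp, by simp, ?_, ?_⟩
      · rw [nodup_iff_le]
        intro c hc
        obtain ⟨U, hU, hUc⟩ := exists_le_map_eq_of_le_map hc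
        obtain ⟨x, y, rfl⟩ := card_eq_two.1 (by simpa using congrArg card hUc)
        have hx : red 2 x ∈ c ::ₘ c ::ₘ 0 := hUc ▸ mem_map_of_mem _ (by simp)
        have hy : red 2 y ∈ c ::ₘ c ::ₘ 0 := hUc ▸ mem_map_of_mem _ (by simp)
        have hx : red 2 x = c := by simpa using hx
        have hy : red 2 y = c := by simpa using hy
        exact h _ hU (isBlock_pair (hx.trans hy.symm))
      · intro h₀
        obtain ⟨x, hx, hx₀⟩ := mem_map.1 h₀
        exact h {x} (singleton_le.2 hx) (isBlock_singleton hx₀)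

section Fintype

variable [Fintype ι]

open scoped Classical in
/-- The nonzero vectors modulo `2`. -/
noncomputable def nonzeroClasses (ι : Type*) [Fintype ι] : Finset (ι → ZMod 2) :=
  Finset.univ.erase 0

theorem mem_nonzeroClasses {c : ι → ZMod 2} : c ∈ nonzeroClasses ι ↔ c ≠ 0 := by
  classical
  simp [nonzeroClasses]

theorem card_nonzeroClasses : (nonzeroClasses ι).card = 2 ^ Fintype.card ι - 1 := by
  classical
  rw [nonzeroClasses, Finset.card_erase_of_mem (Finset.mem_univ _), Finset.card_univ,
    Fintype.card_pi]
  simp [ZMod.card]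

theorem le_nonzeroClasses {W : Multiset (ι → ZMod 2)} (h : W.Nodup) (h₀ : 0 ∉ W) :
    W ≤ (nonzeroClasses ι).val := by
  rw [le_iff_subset h]
  intro c hc
  rw [Finset.mem_val, mem_nonzeroClasses]
  rintro rfl
  exact h₀ hc

theorem ShortFree.card_le {a : ℕ} {S : Multiset (ι → ℤ)} (hS : ShortFree a S) :
    card S ≤ (nonzeroClasses ι).card * (2 ^ a - 1) := by
  induction a generalizing S with
  | zero =>
    suffices S = 0 by simp [this]
    by_contra h
    obtain ⟨x, hx⟩ := exists_mem_of_ne_zero h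
    exact hS {x} (singleton_le.2 hx) (by simp) (by simp) (Subsingleton.elim (α := ι → ZMod 1) _ _)
  | succ a ih =>
    obtain ⟨P, R, hP, rfl, hR, hR₀⟩ := exists_blocks S
    have h₁ := ih (hS.halves hP (Multiset.le_add_right _ _))
    have h₂ := Multiset.card_le_card (le_nonzeroClasses hR hR₀)
    have h₃ := card_join_le hP
    rw [card_map] at h₁ h₂
    rw [Finset.card_val] at h₂
    rw [card_add]
    obtain ⟨k, hk⟩ : ∃ k, 2 ^ a = k + 1 := Nat.exists_eq_succ_of_ne_zero (by positivity)
    rw [pow_succ, hk, show (k + 1) * 2 - 1 = 2 * k + 1 by omega]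
    rw [hk, Nat.add_sub_cancel] at h₁
    linarith

/-- A sequence without short zero-sum subsequence of the maximal possible length. -/
structure Extremal (a : ℕ) (S : Multiset (ι → ℤ)) : Prop where
  shortFree : ShortFree a S
  card_eq : card S = (nonzeroClasses ι).card * (2 ^ a - 1)

theorem Extremal.exists_blocks {a : ℕ} {S : Multiset (ι → ℤ)} (hS : Extremal (a + 1) S)
    {P₀ : Multiset (Multiset (ι → ℤ))} (hP₀ : ∀ B ∈ P₀, IsBlock B) (hle : P₀.join ≤ S) :
    ∃ (P : Multiset (Multiset (ι → ℤ))) (R : Multiset (ι → ℤ)), (∀ B ∈ P, IsBlock B) ∧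
      (P₀ + P).join + R = S ∧ card (P₀ + P).join = 2 * card (P₀ + P) ∧
      card (P₀ + P) = (nonzeroClasses ι).card * (2 ^ a - 1) ∧
      R.map (red 2) = (nonzeroClasses ι).val := by
  obtain ⟨S', rfl⟩ := Multiset.le_iff_exists_add.1 hle
  obtain ⟨P, R, hP, rfl, hR, hR₀⟩ := ShortZeroSum.exists_blocks S'
  have hPP : ∀ B ∈ P₀ + P, IsBlock B := fun B hB => (mem_add.1 hB).elim (hP₀ B) (hP B)
  have hsum : (P₀ + P).join + R = P₀.join + (P.join + R) := by rw [join_add, add_assoc]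
  have hlR := le_nonzeroClasses hR hR₀
  have h₁ := (hS.shortFree.halves hPP (hsum ▸ Multiset.le_add_right _ _)).card_le
  have h₂ := Multiset.card_le_card hlR
  have h₃ := card_join_le hPP
  have h₄ := hS.card_eq
  obtain ⟨k, hk⟩ : ∃ k, 2 ^ a = k + 1 := Nat.exists_eq_succ_of_ne_zero (by positivity)
  rw [← hsum, card_add, pow_succ, hk, show (k + 1) * 2 - 1 = 2 * k + 1 by omega, mul_add,
    mul_one, mul_left_comm] at h₄
  rw [card_map] at h₁ h₂
  rw [Finset.card_val] at h₂
  rw [hk, Nat.add_sub_cancel] at h₁ ⊢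
  refine ⟨P, R, hP, hsum, by omega, by omega, eq_of_le_of_card_le hlR ?_⟩
  rw [card_map, Finset.card_val]
  omega

theorem Extremal.red_two_ne_zero {a : ℕ} {S : Multiset (ι → ℤ)} (hS : Extremal a S)
    {x : ι → ℤ} (hx : x ∈ S) : red 2 x ≠ 0 := by
  intro h
  cases a with
  | zero =>
    have : S = 0 := card_eq_zero.1 (by simpa using hS.card_eq)
    simp [this] at hx
  | succ a =>
    obtain ⟨P, R, hP, -, hc, -⟩ := hS.exists_blocks (P₀ := {{x}})
      (by simpa using isBlock_singleton h) (by simpa using hx)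
    have := card_join_le hP
    rw [join_add, join_singleton, card_add, card_add, card_singleton, card_singleton] at hc
    omega

theorem Extremal.count_le {a : ℕ} {S : Multiset (ι → ℤ)} [DecidableEq (ι → ZMod 2)]
    (hS : Extremal a S)
    (h : ∀ x ∈ S, ∀ y ∈ S, red 2 x = red 2 y → red (2 ^ a) x = red (2 ^ a) y) (c : ι → ZMod 2) :
    count c (S.map (red 2)) ≤ 2 ^ a - 1 := by
  by_contra! hlt
  obtain ⟨U, hU, hUc⟩ := exists_le_map_eq_of_le_map
    (le_count_iff_replicate_le.1 (show 2 ^ a ≤ count c (S.map (red 2)) by omega))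
  have hcard : card U = 2 ^ a := by simpa using congrArg card hUc
  have hU₀ : U ≠ 0 := by
    rw [← card_pos, hcard]
    positivity
  obtain ⟨x, hx⟩ := exists_mem_of_ne_zero hU₀
  have hmem : ∀ y ∈ U, red 2 y = c := fun y hy =>
    eq_of_mem_replicate (hUc ▸ mem_map_of_mem (red 2) hy)
  refine hS.shortFree U hU hU₀ hcard.le ?_
  have hrep : U.map (red (2 ^ a)) = replicate (2 ^ a) (red (2 ^ a) x) := by
    rw [eq_replicate, card_map, hcard]
    refine ⟨rfl, fun z hz => ?_⟩
    obtain ⟨y, hy, rfl⟩ := mem_map.1 hz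
    exact h y (mem_of_le hU hy) x (mem_of_le hU hx) ((hmem y hy).trans (hmem x hx).symm)
  rw [map_multiset_sum, hrep, sum_replicate, nsmul_red]

theorem Extremal.count_eq_of_red_eq {a : ℕ} {S : Multiset (ι → ℤ)} [DecidableEq (ι → ZMod 2)]
    (hS : Extremal a S)
    (h : ∀ x ∈ S, ∀ y ∈ S, red 2 x = red 2 y → red (2 ^ a) x = red (2 ^ a) y)
    {c : ι → ZMod 2} (hc : c ≠ 0) : count c (S.map (red 2)) = 2 ^ a - 1 := by
  have hsum : ∑ c ∈ nonzeroClasses ι, count c (S.map (red 2)) =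
      ∑ _c ∈ nonzeroClasses ι, (2 ^ a - 1) := by
    rw [sum_count_eq_card, card_map, hS.card_eq, Finset.sum_const, smul_eq_mul]
    intro d hd
    obtain ⟨x, hx, rfl⟩ := mem_map.1 hd
    exact mem_nonzeroClasses.2 (hS.red_two_ne_zero hx)
  exact (Finset.sum_eq_sum_iff_of_le fun c _ => hS.count_le h c).1 hsum c
    (mem_nonzeroClasses.2 hc)

theorem Extremal.red_eq_of_cons {a : ℕ} {B : Multiset (ι → ℤ)} {u v : ι → ℤ}
    (hu : Extremal a (u ::ₘ B)) (hv : Extremal a (v ::ₘ B))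
    (h : ∀ S : Multiset (ι → ℤ), Extremal a S →
      ∀ x ∈ S, ∀ y ∈ S, red 2 x = red 2 y → red (2 ^ a) x = red (2 ^ a) y) :
    red (2 ^ a) u = red (2 ^ a) v := by
  classical
  have hu₀ := hu.red_two_ne_zero (mem_cons_self u B)
  have h₁ := hu.count_eq_of_red_eq (h _ hu) hu₀
  have h₂ := hv.count_eq_of_red_eq (h _ hv) hu₀
  rw [map_cons, count_cons] at h₁ h₂
  have huv : red 2 u = red 2 v := by
    by_contra hne
    simp only [hne, if_true, if_false] at h₁ h₂
    omega
  by_cases hB : red 2 u ∈ B.map (red 2)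
  · obtain ⟨w, hw, hwu⟩ := mem_map.1 hB
    exact (h _ hu u (mem_cons_self u B) w (mem_cons_of_mem hw) hwu.symm).trans
      (h _ hv w (mem_cons_of_mem hw) v (mem_cons_self v B) (hwu.trans huv))
  · rw [count_eq_zero_of_notMem hB, if_pos rfl] at h₁
    have ha : a = 1 := by
      have : 2 ^ a = 2 ^ 1 := by omega
      exact Nat.pow_right_injective le_rfl this
    subst ha
    exact huv

theorem Extremal.red_eq {a : ℕ} {S : Multiset (ι → ℤ)} (hS : Extremal a S) {x y : ι → ℤ}
    (hx : x ∈ S) (hy : y ∈ S) (hxy : red 2 x = red 2 y) : red (2 ^ a) x = red (2 ^ a) y := by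
  induction a generalizing S x y with
  | zero => exact Subsingleton.elim (α := ι → ZMod 1) _ _
  | succ a ih =>
    suffices key : ∀ y ∈ S, ∀ z ∈ S, y ≠ z → red 2 y = red 2 z →
        red (2 ^ (a + 1)) y = red (2 ^ (a + 1)) z by
      by_cases h : x = y
      · rw [h]
      · exact key x hx y hy h hxy
    clear hx hy hxy x y
    intro y hy z hz hne hyz
    obtain ⟨P, R, hP, hsum, -, hc, hR⟩ := hS.exists_blocks (P₀ := {{y, z}})
      (by simpa using isBlock_pair hyz) (by simpa using pair_le_of_mem_of_ne hy hz hne)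
    have hmem : red 2 y ∈ R.map (red 2) := by
      rw [hR, Finset.mem_val, mem_nonzeroClasses]
      exact hS.red_two_ne_zero hy
    obtain ⟨x, hx, hxy⟩ := mem_map.1 hmem
    obtain ⟨R, rfl⟩ := exists_cons_of_mem hx
    have hext : ∀ w w' : ι → ℤ, red 2 x = red 2 w → x ::ₘ w ::ₘ w' ::ₘ (P.join + R) = S →
        Extremal a (half (x + w) ::ₘ P.map fun B => half B.sum) := by
      intro w w' hw hS'
      have hB : ∀ B ∈ {x, w} ::ₘ P, IsBlock B := by
        intro B hB
        rcases mem_cons.1 hB with rfl | hB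
        exacts [isBlock_pair hw, hP B hB]
      have hle : ({x, w} ::ₘ P).join ≤ S := by
        rw [← hS', join_cons, insert_eq_cons, cons_add, singleton_add, cons_le_cons_iff,
          cons_le_cons_iff]
        exact (Multiset.le_add_right _ _).trans (le_cons_self _ _)
      have := hS.shortFree.halves hB hle
      rw [map_cons, insert_eq_cons, sum_cons, sum_singleton] at this
      refine ⟨this, ?_⟩
      rw [← hc]
      simp [add_comm]
    have hS₁ : x ::ₘ y ::ₘ z ::ₘ (P.join + R) = S := by
      rw [← hsum]
      rw [join_add, join_singleton]
      simp only [insert_eq_cons, cons_add, singleton_add, add_cons]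
    have hS₂ : x ::ₘ z ::ₘ y ::ₘ (P.join + R) = S := by rw [cons_swap z y, hS₁]
    have hxz := hxy.trans hyz
    have heq := (hext y z hxy hS₁).red_eq_of_cons (hext z y hxz hS₂)
      fun S hS x hx y hy => ih hS hx hy
    rw [← sub_eq_zero, ← map_sub, ← red_two_nsmul_eq_zero_iff, smul_sub,
      two_nsmul_half (red_two_add_eq_zero hxy),
      two_nsmul_half (red_two_add_eq_zero hxz)] at heq
    rwa [add_sub_add_left_eq_sub, map_sub, sub_eq_zero] at heq

theorem Extremal.red_sum_ne_zero {a : ℕ} {S : Multiset (ι → ℤ)} (hS : Extremal a S)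
    (ha : Fintype.card ι ≤ a) (hι : 0 < Fintype.card ι) : red (2 ^ a) S.sum ≠ 0 := by
  classical
  intro h₀
  have hcount := fun c => hS.count_eq_of_red_eq (c := c) fun x hx y hy => hS.red_eq hx hy
  have h2a : 2 ≤ 2 ^ a := by
    calc 2 = 2 ^ 1 := rfl
      _ ≤ 2 ^ a := Nat.pow_le_pow_right two_pos (hι.trans_le ha)
  have hrep : ∀ c : ι → ZMod 2, ∃ x, c ≠ 0 → x ∈ S ∧ red 2 x = c := by
    intro c
    by_cases hc : c = 0
    · exact ⟨0, fun h => absurd hc h⟩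
    · have : c ∈ S.map (red 2) := by
        rw [← count_pos, hcount c hc]
        omega
      obtain ⟨x, hx⟩ := mem_map.1 this
      exact ⟨x, fun _ => hx⟩
  choose g hg using hrep
  have hsum : red (2 ^ a) S.sum = (2 ^ a - 1) • ∑ c ∈ nonzeroClasses ι, red (2 ^ a) (g c) := by
    have hfin : (S.map (red 2)).toFinset = nonzeroClasses ι := by
      ext c
      rw [mem_toFinset, mem_nonzeroClasses]
      constructor
      · intro hc
        obtain ⟨x, hx, rfl⟩ := mem_map.1 hc
        exact hS.red_two_ne_zero hx
      · intro hc
        exact hg c hc |>.2 ▸ mem_map_of_mem _ (hg c hc).1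
    have hmap : S.map (red (2 ^ a)) = (S.map (red 2)).map fun c => red (2 ^ a) (g c) := by
      rw [map_map]
      refine map_congr rfl fun x hx => ?_
      have := hg _ (hS.red_two_ne_zero hx)
      exact hS.red_eq hx this.1 this.2.symm
    rw [map_multiset_sum, hmap, Finset.sum_multiset_map_count, hfin, Finset.smul_sum]
    exact Finset.sum_congr rfl fun c hc => by rw [hcount c (mem_nonzeroClasses.1 hc)]
  set σ := ∑ c ∈ nonzeroClasses ι, red (2 ^ a) (g c)
  have hσ : σ = 0 := by
    have h₁ : (2 ^ a - 1) • σ + σ = 0 := by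
      rw [← succ_nsmul, Nat.sub_add_cancel (by omega), nsmul_red]
    rwa [← hsum, h₀, zero_add] at h₁
  have hcard := card_nonzeroClasses (ι := ι)
  have hpow : 2 ^ Fintype.card ι ≤ 2 ^ a := Nat.pow_le_pow_right two_pos ha
  have hpow' : 2 ^ 1 ≤ 2 ^ Fintype.card ι := Nat.pow_le_pow_right two_pos hι
  refine hS.shortFree ((nonzeroClasses ι).val.map g) ?_ ?_ ?_ ?_
  · rw [le_iff_subset]
    · intro x hx
      obtain ⟨c, hc, rfl⟩ := mem_map.1 hx
      exact (hg c (mem_nonzeroClasses.1 hc)).1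
    · refine Nodup.map_on ?_ (nonzeroClasses ι).nodup
      intro c hc d hd hcd
      rw [← (hg c (mem_nonzeroClasses.1 hc)).2, hcd, (hg d (mem_nonzeroClasses.1 hd)).2]
  · rw [← card_pos, card_map, Finset.card_val]
    omega
  · rw [card_map, Finset.card_val]
    omega
  · rw [map_multiset_sum, map_map]
    exact hσ

theorem sum_nonzeroClasses (hι : 2 ≤ Fintype.card ι) : ∑ c ∈ nonzeroClasses ι, c = 0 := by
  classical
  rw [nonzeroClasses, Finset.sum_erase (f := fun c : ι → ZMod 2 => c) _ rfl]
  ext i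
  obtain ⟨j, hj⟩ : ∃ j, j ≠ i :=
    haveI := Fintype.one_lt_card_iff_nontrivial.1 hι
    exists_ne i
  rw [Finset.sum_apply, Pi.zero_apply]
  refine Finset.sum_involution (fun c _ => c + Pi.single j 1) ?_ ?_ (by simp) ?_
  · intro c _
    simp [hj.symm, CharTwo.add_self_eq_zero]
  · intro c _ _ h
    have := congrFun h j
    simp at this
  · intro c _
    rw [add_assoc, ← Pi.single_add, CharTwo.add_self_eq_zero, Pi.single_zero, add_zero]

theorem ShortFree.red_two_sum_ne_zero {S : Multiset (ι → ℤ)} (hS : ShortFree 1 S)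
    (hι : 2 ≤ Fintype.card ι) (hc : card S + 1 = (nonzeroClasses ι).card) : red 2 S.sum ≠ 0 := by
  classical
  intro h₀
  obtain ⟨P, R, hP, rfl, hR, hR₀⟩ := exists_blocks S
  have hP₀ : P = 0 := by
    by_contra h
    obtain ⟨B, hB⟩ := exists_mem_of_ne_zero h
    refine hS B ?_ (hP B hB).ne_zero (by simpa using (hP B hB).card_le) (hP B hB).red_sum
    refine le_trans ?_ (Multiset.le_add_right _ _)
    rw [← join_singleton B]
    exact join_le_join (singleton_le.2 hB)
  subst hP₀
  rw [join_zero, zero_add] at h₀ hc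
  obtain ⟨W, hW⟩ := Multiset.le_iff_exists_add.1 (le_nonzeroClasses hR hR₀)
  have hWc : card W = 1 := by
    have := congrArg card hW
    rw [card_add, card_map, Finset.card_val] at this
    omega
  obtain ⟨c, rfl⟩ := card_eq_one.1 hWc
  have hc₀ : c ≠ 0 := by
    rw [← mem_nonzeroClasses, ← Finset.mem_val, hW]
    simp
  have hsum := congrArg Multiset.sum hW
  rw [sum_add, ← map_multiset_sum, h₀, sum_singleton, zero_add] at hsum
  refine hc₀ (hsum.symm.trans ?_)
  rw [← Multiset.map_id' (nonzeroClasses ι).val]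
  exact sum_nonzeroClasses hι

end Fintype

section Lift

/-- The integer representative, with entries in `[0, 2 ^ a)`, of a vector modulo `2 ^ a`. -/
def lift (a : ℕ) (x : ι → ZMod (2 ^ a)) : ι → ℤ := fun i => (x i).val

theorem red_lift (a : ℕ) (x : ι → ZMod (2 ^ a)) : red (2 ^ a) (lift a x) = x := by
  ext i
  simp [lift]

theorem red_sum_map_lift (a : ℕ) (S : Multiset (ι → ZMod (2 ^ a))) :
    red (2 ^ a) (S.map (lift a)).sum = S.sum := by
  rw [map_multiset_sum, map_map]
  simp [red_lift]

theorem exponent_pi_zmod [Nonempty ι] (n : ℕ) : AddMonoid.exponent (ι → ZMod n) = n := by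
  apply Nat.dvd_antisymm
  · exact AddMonoid.exponent_dvd_of_forall_nsmul_eq_zero (nsmul_red n)
  · obtain ⟨i⟩ := ‹Nonempty ι›
    conv_lhs => rw [← ZMod.exponent n]
    exact AddMonoid.exponent_dvd_of_forall_nsmul_eq_zero fun x =>
      congrFun (AddMonoid.exponent_nsmul_eq_zero (fun _ : ι => x)) i

theorem hasShortZeroSumSubseq_iff [Nonempty ι] {a : ℕ} {S : Multiset (ι → ZMod (2 ^ a))} :
    HasShortZeroSumSubseq S ↔ ¬ ShortFree a (S.map (lift a)) := by
  simp only [HasShortZeroSumSubseq, ShortFree, exponent_pi_zmod]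
  push Not
  constructor
  · rintro ⟨T, hT, hT₀, hT₁, hTc⟩
    refine ⟨T.map (lift a), map_le_map hT, ?_, by simpa using hTc, by rwa [red_sum_map_lift]⟩
    rw [← card_pos, card_map]
    exact hT₁
  · rintro ⟨T, hT, hT₁, hTc, hT₀⟩
    obtain ⟨U, hU, rfl⟩ := exists_le_map_eq_of_le_map hT
    rw [red_sum_map_lift] at hT₀
    rw [← card_pos, card_map] at hT₁
    exact ⟨U, hU, hT₀, hT₁, by simpa using hTc⟩

end Lift

theorem davenport_add_one_le {G : Type*} [AddCommGroup G] {t : ℕ}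
    (ht : AddMonoid.exponent G < t) (ht₂ : 2 ≤ t)
    (h : ∀ S : Multiset G, card S = t → S.sum = 0 → HasShortZeroSumSubseq S) :
    davenport G + 1 ≤ t := by
  classical
  suffices davenport G ≤ t - 1 by omega
  refine Nat.sInf_le fun S hS => ?_
  obtain ⟨S', hS', hc⟩ := exists_le_card_eq_of_le_card hS
  obtain ⟨T, hT, hT₀, hT₁, hTc⟩ := h (-S'.sum ::ₘ S') (by rw [card_cons]; omega) (by simp)
  by_cases hmem : T ≤ S'
  · exact ⟨T, hmem.trans hS', card_pos.1 hT₁, hT₀⟩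
  · have hx : -S'.sum ∈ T := by
      by_contra hx
      exact hmem ((le_cons_of_notMem hx).1 hT)
    obtain ⟨T', rfl⟩ := exists_cons_of_mem hx
    obtain ⟨U, rfl⟩ := Multiset.le_iff_exists_add.1 ((cons_le_cons_iff _).1 hT)
    refine ⟨U, (Multiset.le_add_left U T').trans hS', ?_, ?_⟩
    · rintro rfl
      rw [card_cons] at hTc
      rw [add_zero] at hc
      omega
    · simpa using hT₀

section Eta

theorem sum_val_eq_card_filter (W : Multiset (ι → ZMod 2)) (i : ι) :
    (W.map fun c => (c i).val).sum = card (W.filter fun c => c i ≠ 0) := by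
  induction W using Multiset.induction_on with
  | empty => simp
  | cons c W ih =>
    rw [map_cons, sum_cons, ih]
    obtain h | h : c i = 0 ∨ c i = 1 := by
      generalize c i = z
      revert z
      decide
    · rw [filter_cons_of_neg _ (by simp [h]), h, ZMod.val_zero, zero_add]
    · rw [filter_cons_of_pos _ (by simp [h]), h, card_cons, add_comm]
      rfl

variable [Fintype ι] [Nonempty ι]

/-- The vector modulo `n` with the same `0`, `1` entries as a vector modulo `2`. -/
def zeroOne (n : ℕ) (c : ι → ZMod 2) : ι → ZMod n := fun i => ((c i).val : ZMod n)

theorem not_hasShortZeroSumSubseq_zeroOne {a : ℕ} :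
    ¬ HasShortZeroSumSubseq
      (((2 ^ a - 1) • (nonzeroClasses ι).val).map (zeroOne (2 ^ a))) := by
  classical
  rintro ⟨T, hT, hT₀, hT₁, hTc⟩
  rw [exponent_pi_zmod] at hTc
  obtain ⟨W, hW, rfl⟩ := exists_le_map_eq_of_le_map hT
  rw [card_map] at hT₁ hTc
  have hmem : ∀ c ∈ W, c ≠ 0 := fun c hc =>
    mem_nonzeroClasses.1 (Multiset.mem_of_mem_nsmul (mem_of_le hW hc))
  have hdvd : ∀ i, 2 ^ a ∣ card (W.filter fun c => c i ≠ 0) := by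
    intro i
    rw [← sum_val_eq_card_filter, ← ZMod.natCast_eq_zero_iff]
    have := congrArg (Pi.evalAddMonoidHom (fun _ : ι => ZMod (2 ^ a)) i) hT₀
    rw [map_multiset_sum, map_map, _root_.map_zero] at this
    rw [Nat.cast_multiset_sum, map_map]
    exact this
  have hle : ∀ i, card (W.filter fun c => c i ≠ 0) ≤ card W := fun i =>
    Multiset.card_le_card (filter_le _ _)
  have hall : ∀ i, ∀ c ∈ W, c i ≠ 0 → card W = 2 ^ a ∧ ∀ d ∈ W, d i ≠ 0 := by
    intro i c hc hci
    have hpos : 0 < card (W.filter fun c => c i ≠ 0) :=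
      card_pos_iff_exists_mem.2 ⟨c, mem_filter.2 ⟨hc, hci⟩⟩
    have h₁ := Nat.le_of_dvd hpos (hdvd i)
    have h₂ := hle i
    refine ⟨by omega, ?_⟩
    exact filter_eq_self.1 (eq_of_le_of_card_le (filter_le _ _) (by omega))
  obtain ⟨c, hc⟩ := card_pos_iff_exists_mem.1 hT₁
  obtain ⟨i, hi⟩ := Function.ne_iff.1 (hmem c hc)
  have hcard := (hall i c hc hi).1
  have hrep : W = replicate (2 ^ a) c := by
    refine eq_replicate.2 ⟨hcard, fun d hd => ?_⟩
    have hiff : ∀ j, d j ≠ 0 ↔ c j ≠ 0 := fun j =>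
      ⟨fun h => (hall j d hd h).2 c hc, fun h => (hall j c hc h).2 d hd⟩
    ext j
    have := hiff j
    revert this
    generalize d j = y
    generalize c j = z
    revert y z
    decide
  have hcount := le_count_iff_replicate_le.2 (hrep ▸ hW)
  rw [count_nsmul] at hcount
  have h₁ := nodup_iff_count_le_one.1 (nonzeroClasses ι).nodup c
  have h₂ : (2 ^ a - 1) * count c (nonzeroClasses ι).val ≤ (2 ^ a - 1) * 1 :=
    Nat.mul_le_mul_left _ h₁
  have h₃ : 0 < 2 ^ a := by positivity
  omega

theorem lt_etaConst {a : ℕ} :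
    (nonzeroClasses ι).card * (2 ^ a - 1) < etaConst (ι → ZMod (2 ^ a)) := by
  refine Nat.succ_le_of_lt ?_
  refine le_csInf ⟨(nonzeroClasses ι).card * (2 ^ a - 1) + 1, fun S hS => ?_⟩ fun d hd => ?_
  · rw [hasShortZeroSumSubseq_iff]
    intro h
    have := h.card_le
    rw [card_map] at this
    omega
  · by_contra hlt
    refine not_hasShortZeroSumSubseq_zeroOne (ι := ι) (a := a) (hd _ ?_)
    rw [card_map, card_nsmul, Finset.card_val, mul_comm]
    omega

end Eta

end ShortZeroSum

open ShortZeroSum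

theorem stmt_4 (a r : ℕ) (h : (3 ≤ r ∧ r ≤ a) ∨ (a = 1 ∧ 3 ≤ r)) :
    (C0 (Fin r → ZMod (2 ^ a))).Nonempty := by
  have hr : 3 ≤ r := by omega
  have : Nonempty (Fin r) := ⟨⟨0, by omega⟩⟩
  have hq : (nonzeroClasses (Fin r)).card = 2 ^ r - 1 := by
    rw [card_nonzeroClasses, Fintype.card_fin]
  have hq8 : 2 ^ 3 ≤ 2 ^ r := Nat.pow_le_pow_right two_pos hr
  have hη := lt_etaConst (ι := Fin r) (a := a)
  suffices ∃ t, 2 ^ a < t ∧ 2 ≤ t ∧ t ≤ (nonzeroClasses (Fin r)).card * (2 ^ a - 1) ∧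
      ∀ S : Multiset (Fin r → ZMod (2 ^ a)), Multiset.card S = t → S.sum = 0 →
        HasShortZeroSumSubseq S by
    obtain ⟨t, ht, ht₂, htη, hS⟩ := this
    refine ⟨t, davenport_add_one_le (by rwa [exponent_pi_zmod]) ht₂ hS, by omega, hS⟩
  rcases h with ⟨-, hra⟩ | ⟨rfl, -⟩
  · have ha : 2 ^ 1 ≤ 2 ^ a := Nat.pow_le_pow_right two_pos (by omega)
    have hmul : 7 * (2 ^ a - 1) ≤ (nonzeroClasses (Fin r)).card * (2 ^ a - 1) :=
      Nat.mul_le_mul_right _ (by omega)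
    refine ⟨_, by omega, by omega, le_rfl, fun S hS h₀ => ?_⟩
    rw [hasShortZeroSumSubseq_iff]
    intro hfree
    refine Extremal.red_sum_ne_zero ⟨hfree, by rwa [Multiset.card_map]⟩ ?_ ?_
      (by rwa [red_sum_map_lift])
    · rwa [Fintype.card_fin]
    · rw [Fintype.card_fin]
      omega
  · refine ⟨(nonzeroClasses (Fin r)).card - 1, by omega, by omega, by omega, fun S hS h₀ => ?_⟩
    rw [hasShortZeroSumSubseq_iff]
    intro hfree
    refine hfree.red_two_sum_ne_zero ?_ ?_ (by simpa [h₀] using red_sum_map_lift 1 S)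
    · rw [Fintype.card_fin]
      omega
    · rw [Multiset.card_map, hS]
      omega
end
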